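/- arXiv:2512.12886 — 4 statements merged into one kernel-verified Lean document; each statement's English description precedes it below -/
import Mathlib

section
/- Let k be a field and let m_1,…,m_k be squarefree monomials in k[x_1,…,x_n,y] such that y does not divide m_i for any i. If I = ⟨m_1,…,m_k⟩ is geometrically vertex decomposable, then J = I + ⟨y⟩ is also geometrically vertex decomposable. -/
open scoped Classical

section GVDDefs

/-- The squarefree monomial whose support is the finite set `s`. -/
noncomputable def sqMono (k : Type) [Field k] {σ : Type} (s : Finset σ) : MvPolynomial σ k :=
  ∏ i ∈ s, MvPolynomial.X i

/-- The squarefree monomial ideal generated by the monomials with supports in `F`. -/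
noncomputable def sqSpan (k : Type) [Field k] {σ : Type} (F : Set (Finset σ)) :
    Ideal (MvPolynomial σ k) :=
  Ideal.span {m | ∃ s ∈ F, m = sqMono k s}

/-- The height of a prime ideal. -/
noncomputable def primeHt {R : Type*} [CommRing R] (P : Ideal R) (hP : P.IsPrime) : ℕ∞ :=
  Order.height (⟨P, hP⟩ : PrimeSpectrum R)

/-- An ideal is unmixed if all of its minimal primes have the same height. -/
def UnmixedIdeal {R : Type*} [CommRing R] (I : Ideal R) : Prop :=
  ∀ P Q : Ideal R, ∀ hP : P ∈ I.minimalPrimes, ∀ hQ : Q ∈ I.minimalPrimes,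
    primeHt P hP.1.1 = primeHt Q hQ.1.1

/-- View a finset of `σ` as a finset of `{x : σ // x ≠ y}` (dropping `y`). -/
noncomputable def dropVar {σ : Type} (y : σ) (s : Finset σ) : Finset {x : σ // x ≠ y} :=
  s.subtype (· ≠ y)

/-- Supports of the generators of `N_{y,I}`: the given generators not divisible by `y`. -/
def NFam {σ : Type} (y : σ) (F : Set (Finset σ)) : Set (Finset σ) := {s ∈ F | y ∉ s}

/-- Supports of the generators of `C_{y,I}`: the given generators with `y` divided out
(together with the generators not divisible by `y`). -/
noncomputable def CFam {σ : Type} (y : σ) (F : Set (Finset σ)) : Set (Finset σ) :=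
  (fun s => s.erase y) '' F

/-- A squarefree monomial ideal `I` is geometrically vertex decomposable if it is unmixed
and either (1) `I = ⟨1⟩` or `I` is generated by a subset of the variables, or (2) there is
a set of squarefree monomial generators of `I` and a variable `y` such that
`I = C_{y,I} ∩ (N_{y,I} + ⟨y⟩)` and both `C_{y,I}` and `N_{y,I}` are geometrically vertex
decomposable in the polynomial ring omitting the variable `y`. -/
inductive IsGVD (k : Type) [Field k] : (σ : Type) → Ideal (MvPolynomial σ k) → Prop where
  | base (σ : Type) (I : Ideal (MvPolynomial σ k)) (hunm : UnmixedIdeal I)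
      (h : I = ⊤ ∨ ∃ W : Set σ, I = Ideal.span (MvPolynomial.X '' W)) : IsGVD k σ I
  | step (σ : Type) (I : Ideal (MvPolynomial σ k)) (hunm : UnmixedIdeal I)
      (F : Set (Finset σ)) (hgen : I = sqSpan k F) (y : σ)
      (hdec : I = sqSpan k (CFam y F) ⊓ (sqSpan k (NFam y F) ⊔ Ideal.span {MvPolynomial.X y}))
      (hC : IsGVD k {x : σ // x ≠ y} (sqSpan k (dropVar y '' CFam y F)))
      (hN : IsGVD k {x : σ // x ≠ y} (sqSpan k (dropVar y '' NFam y F))) :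
      IsGVD k σ I

end GVDDefs

/-- `s` contains a member of `F`. -/
def UpMem {σ : Type} (F : Set (Finset σ)) (s : Finset σ) : Prop := ∃ t ∈ F, t ⊆ s

/-- the prime generated by the variables in `T` -/
noncomputable def varIdeal (k : Type) [Field k] {σ : Type} (T : Set σ) :
    Ideal (MvPolynomial σ k) := Ideal.span (MvPolynomial.X '' T)

/-- `T` meets every member of `F`. -/
def Hits {σ : Type} (F : Set (Finset σ)) (T : Set σ) : Prop := ∀ s ∈ F, ∃ i ∈ s, i ∈ T

theorem sqMono_eq (k : Type) [Field k] {σ : Type} (s : Finset σ) :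
    sqMono k s = MvPolynomial.monomial (∑ i ∈ s, Finsupp.single i 1) 1 := by
  simp only [sqMono, MvPolynomial.X, MvPolynomial.monomial_sum_one]

theorem expo_le {σ : Type} (s : Finset σ) (m : σ →₀ ℕ) :
    (∑ i ∈ s, Finsupp.single i 1) ≤ m ↔ s ⊆ m.support := by
  rw [Finsupp.le_def]
  have h : ∀ i, (∑ j ∈ s, Finsupp.single j 1 : σ →₀ ℕ) i = if i ∈ s then 1 else 0 := by
    intro i
    simp [Finsupp.finsetSum_apply, Finsupp.single_apply]
  constructor
  · intro H i hi
    have := H i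
    rw [h, if_pos hi] at this
    simp; omega
  · intro H i
    rw [h]
    split_ifs with hi
    · have := H hi
      simp at this; omega
    · omega

theorem mem_sqSpan (k : Type) [Field k] {σ : Type} (F : Set (Finset σ)) (p : MvPolynomial σ k) :
    p ∈ sqSpan k F ↔ ∀ m ∈ p.support, UpMem F m.support := by
  have : {m | ∃ s ∈ F, m = sqMono k s} =
      (fun s => MvPolynomial.monomial s (1 : k)) ''
        ((fun s : Finset σ => (∑ i ∈ s, Finsupp.single i 1 : σ →₀ ℕ)) '' F) := by
    ext m
    simp only [sqMono_eq, Set.mem_ofPred_eq, Set.mem_image, exists_exists_and_eq_and]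
    constructor
    · rintro ⟨s, hs, rfl⟩; exact ⟨s, hs, rfl⟩
    · rintro ⟨s, hs, rfl⟩; exact ⟨s, hs, rfl⟩
  rw [sqSpan, this, MvPolynomial.mem_ideal_span_monomial_image]
  simp [UpMem, expo_le]

theorem sqMono_mem (k : Type) [Field k] {σ : Type} (F : Set (Finset σ)) (s : Finset σ) :
    sqMono k s ∈ sqSpan k F ↔ UpMem F s := by
  have hs : (∑ i ∈ s, Finsupp.single i 1 : σ →₀ ℕ).support = s := by
    ext i
    simp [Finsupp.finsetSum_apply, Finsupp.single_apply]
  rw [mem_sqSpan, sqMono_eq]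
  constructor
  · intro h
    have := h (∑ i ∈ s, Finsupp.single i 1) (by simp [MvPolynomial.coeff_monomial])
    rwa [hs] at this
  · intro h m hm
    have := MvPolynomial.support_monomial_subset hm
    rw [Finset.mem_singleton] at this
    rw [this, hs]; exact h

theorem sqSpan_eq_iff (k : Type) [Field k] {σ : Type} (F G : Set (Finset σ)) :
    sqSpan k F = sqSpan k G ↔ ∀ s, UpMem F s ↔ UpMem G s := by
  constructor
  · intro h s
    rw [← sqMono_mem k, ← sqMono_mem k, h]
  · intro h
    ext p
    simp only [mem_sqSpan, h]

theorem varIdeal_eq (k : Type) [Field k] {σ : Type} (T : Set σ) :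
    varIdeal k T = sqSpan k ((fun i => {i}) '' T) := by
  unfold varIdeal sqSpan
  congr 1
  ext p
  simp [sqMono, eq_comm]

theorem span_X_eq (k : Type) [Field k] {σ : Type} (y : σ) :
    Ideal.span {(MvPolynomial.X y : MvPolynomial σ k)} = sqSpan k {{y}} := by
  unfold sqSpan
  congr 1
  ext p
  simp [sqMono]

theorem sqSpan_sup (k : Type) [Field k] {σ : Type} (F G : Set (Finset σ)) :
    sqSpan k F ⊔ sqSpan k G = sqSpan k (F ∪ G) := by
  unfold sqSpan
  rw [← Ideal.span_union]
  congr 1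
  ext p
  simp only [Set.mem_union, Set.mem_ofPred_eq]
  constructor
  · rintro (⟨s, h, e⟩ | ⟨s, h, e⟩)
    exacts [⟨s, .inl h, e⟩, ⟨s, .inr h, e⟩]
  · rintro ⟨s, h | h, e⟩
    exacts [.inl ⟨s, h, e⟩, .inr ⟨s, h, e⟩]

theorem sqSpan_top (k : Type) [Field k] {σ : Type} (F : Set (Finset σ)) :
    sqSpan k F = ⊤ ↔ ∅ ∈ F := by
  rw [Ideal.eq_top_iff_one]
  have : (1 : MvPolynomial σ k) = sqMono k ∅ := by simp [sqMono]
  rw [this, sqMono_mem]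
  simp [UpMem]

/-- The decomposition is automatic for squarefree monomial ideals. -/
theorem sqSpan_decomp (k : Type) [Field k] {σ : Type} (y : σ) (F : Set (Finset σ)) :
    sqSpan k F = sqSpan k (CFam y F) ⊓
      (sqSpan k (NFam y F) ⊔ Ideal.span {MvPolynomial.X y}) := by
  rw [span_X_eq, sqSpan_sup]
  ext p
  rw [Ideal.mem_inf]
  simp only [mem_sqSpan, ← forall_and]
  refine forall_congr' fun m => ?_
  refine imp_congr_right fun _ => ?_
  generalize m.support = s
  constructor
  · rintro ⟨t, ht, hts⟩
    refine ⟨⟨t.erase y, ⟨t, ht, rfl⟩, (Finset.erase_subset _ _).trans hts⟩, ?_⟩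
    by_cases hy : y ∈ t
    · exact ⟨{y}, .inr rfl, by simpa using hts hy⟩
    · exact ⟨t, .inl ⟨ht, hy⟩, hts⟩
  · rintro ⟨⟨_, ⟨t, ht, rfl⟩, hts⟩, ⟨u, hu | hu, hus⟩⟩
    · exact ⟨u, hu.1, hus⟩
    · refine ⟨t, ht, ?_⟩
      rw [Set.mem_singleton_iff] at hu
      subst hu
      intro i hi
      by_cases h : i = y
      · subst h; exact hus (by simp)
      · exact hts (by simp [h, hi])

theorem X_mem_varIdeal (k : Type) [Field k] {σ : Type} (T : Set σ) (i : σ) :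
    (MvPolynomial.X i : MvPolynomial σ k) ∈ varIdeal k T ↔ i ∈ T := by
  have : (MvPolynomial.X i : MvPolynomial σ k) = sqMono k {i} := by simp [sqMono]
  rw [varIdeal_eq, this, sqMono_mem]
  simp [UpMem]

theorem varIdeal_prime (k : Type) [Field k] {σ : Type} (T : Set σ) : (varIdeal k T).IsPrime := by
  let φ : MvPolynomial σ k →ₐ[k] MvPolynomial σ k :=
    MvPolynomial.aeval (fun i => if i ∈ T then 0 else MvPolynomial.X i)
  have hφ : ∀ i, φ (MvPolynomial.X i) = if i ∈ T then 0 else MvPolynomial.X i := by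
    intro i; simp [φ]
  have h1 : ∀ p, p - φ p ∈ varIdeal k T := by
    intro p
    induction p using MvPolynomial.induction_on with
    | C a => simp [φ, MvPolynomial.algebraMap_eq]
    | add p q hp hq =>
      rw [map_add, add_sub_add_comm]; exact add_mem hp hq
    | mul_X p i hp =>
      rw [map_mul, hφ]
      split_ifs with h
      · rw [mul_zero, sub_zero]
        exact Ideal.mul_mem_left _ _ ((X_mem_varIdeal k T i).2 h)
      · rw [← sub_mul]; exact Ideal.mul_mem_right _ _ hp
  have h2 : varIdeal k T = RingHom.ker φ := by
    apply le_antisymm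
    · refine Ideal.span_le.2 ?_
      rintro _ ⟨i, hi, rfl⟩
      simp [RingHom.mem_ker, hφ, hi]
    · intro p hp
      have := h1 p
      rwa [(RingHom.mem_ker).1 hp, sub_zero] at this
  rw [h2]
  exact RingHom.ker_isPrime φ

theorem varIdeal_le (k : Type) [Field k] {σ : Type} (T : Set σ) (P : Ideal (MvPolynomial σ k)) :
    varIdeal k T ≤ P ↔ ∀ i ∈ T, MvPolynomial.X i ∈ P := by
  rw [varIdeal, Ideal.span_le, Set.image_subset_iff]; rfl

theorem varIdeal_mono (k : Type) [Field k] {σ : Type} (S T : Set σ) :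
    varIdeal k S ≤ varIdeal k T ↔ S ⊆ T := by
  rw [varIdeal_le]; simp only [X_mem_varIdeal]; rfl

theorem varIdeal_height (k : Type) [Field k] {σ : Type} [Finite σ] (T : Set σ) :
    (varIdeal k T).height = T.encard := by
  have := varIdeal_prime k T
  apply le_antisymm
  · refine le_trans (Ideal.height_le_card_of_mem_minimalPrimes_span
      (s := MvPolynomial.X '' T) (Set.toFinite _) ?_) ?_
    · change varIdeal k T ∈ (varIdeal k T).minimalPrimes
      rw [Ideal.minimalPrimes_eq_subsingleton_self]; rfl
    · rw [(Set.toFinite _).cast_ncard_eq]; exact Set.encard_image_le _ _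
  · have hf : T.Finite := Set.toFinite T
    clear this
    induction T, hf using Set.Finite.induction_on with
    | empty => simp
    | @insert a S ha _ ih =>
      rw [Set.encard_insert_of_notMem ha]
      have := varIdeal_prime k S
      have := varIdeal_prime k (insert a S)
      refine le_trans (add_le_add_left ih 1) (Ideal.height_add_one_le_of_lt_of_isPrime ?_)
      refine lt_of_le_not_ge ((varIdeal_mono k _ _).2 (Set.subset_insert _ _)) ?_
      rw [varIdeal_mono]
      exact fun h => ha (h (Set.mem_insert _ _))

theorem sqSpan_le_prime (k : Type) [Field k] {σ : Type} (F : Set (Finset σ))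
    (P : Ideal (MvPolynomial σ k)) (hP : P.IsPrime) :
    sqSpan k F ≤ P ↔ Hits F {i | MvPolynomial.X i ∈ P} := by
  rw [sqSpan, Ideal.span_le]
  constructor
  · intro h s hs
    have : sqMono k s ∈ P := h ⟨s, hs, rfl⟩
    rw [sqMono, hP.prod_mem_iff] at this
    exact this
  · rintro h _ ⟨s, hs, rfl⟩
    change sqMono k s ∈ P
    rw [sqMono, hP.prod_mem_iff]
    exact h s hs

theorem minPrimes_iff (k : Type) [Field k] {σ : Type} (F : Set (Finset σ))
    (P : Ideal (MvPolynomial σ k)) :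
    P ∈ (sqSpan k F).minimalPrimes ↔ ∃ T, Minimal (Hits F) T ∧ P = varIdeal k T := by
  have hset : ∀ T : Set σ, {i | (MvPolynomial.X i : MvPolynomial σ k) ∈ varIdeal k T} = T := by
    intro T; ext i; simp [X_mem_varIdeal]
  constructor
  · intro h
    have hP := h.1.1
    have hle := (sqSpan_le_prime k F P hP).1 h.1.2
    have key : ∀ T : Set σ, Hits F T → T ⊆ {i | (MvPolynomial.X i : MvPolynomial σ k) ∈ P} →
        P ≤ varIdeal k T := by
      intro T hT hTP
      refine h.2 ⟨varIdeal_prime k T, ?_⟩ ((varIdeal_le k T P).2 hTP)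
      rw [sqSpan_le_prime k F _ (varIdeal_prime k T), hset]; exact hT
    refine ⟨_, ⟨hle, ?_⟩, le_antisymm (key _ hle subset_rfl) ((varIdeal_le k _ P).2 fun i hi => hi)⟩
    intro T hT hTP i hi
    exact (X_mem_varIdeal k T i).1 (key T hT hTP hi)
  · rintro ⟨T, hT, rfl⟩
    refine ⟨⟨varIdeal_prime k T, ?_⟩, ?_⟩
    · rw [sqSpan_le_prime k F _ (varIdeal_prime k T), hset]; exact hT.1
    · rintro Q ⟨hQ, hFQ⟩ hQT
      rw [varIdeal_le]
      have := hT.2 ((sqSpan_le_prime k F Q hQ).1 hFQ) (fun i hi => (X_mem_varIdeal k T i).1 (hQT hi))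
      exact fun i hi => this hi

theorem primeHt_eq {R : Type*} [CommRing R] (P : Ideal R) (hP : P.IsPrime) :
    primeHt P hP = P.height :=
  (PrimeSpectrum.height_eq_orderHeight ⟨P, hP⟩).symm

theorem unmixed_iff (k : Type) [Field k] {σ : Type} [Finite σ] (F : Set (Finset σ)) :
    UnmixedIdeal (sqSpan k F) ↔
      ∀ S T, Minimal (Hits F) S → Minimal (Hits F) T → S.encard = T.encard := by
  unfold UnmixedIdeal
  simp only [primeHt_eq]
  constructor
  · intro h S T hS hT
    rw [← varIdeal_height k, ← varIdeal_height k]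
    exact h _ _ ((minPrimes_iff k F _).2 ⟨S, hS, rfl⟩) ((minPrimes_iff k F _).2 ⟨T, hT, rfl⟩)
  · intro h P Q hP hQ
    obtain ⟨S, hS, rfl⟩ := (minPrimes_iff k F _).1 hP
    obtain ⟨T, hT, rfl⟩ := (minPrimes_iff k F _).1 hQ
    rw [varIdeal_height, varIdeal_height]
    exact h S T hS hT

/-- Transport of a family along an embedding. -/
def pushFam {τ σ : Type} (f : τ ↪ σ) (G : Set (Finset τ)) : Set (Finset σ) :=
  Finset.map f '' G

theorem hits_push {τ σ : Type} (f : τ ↪ σ) (G : Set (Finset τ)) (T : Set σ) :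
    Hits (pushFam f G) T ↔ Hits G (f ⁻¹' T) := by
  simp [Hits, pushFam]

theorem minimal_push {τ σ : Type} (f : τ ↪ σ) (G : Set (Finset τ)) (T : Set τ)
    (hT : Minimal (Hits G) T) : Minimal (Hits (pushFam f G)) (f '' T) := by
  constructor
  · rw [hits_push, Set.preimage_image_eq _ f.injective]; exact hT.1
  · intro S hS hST
    rw [hits_push] at hS
    have h1 : f ⁻¹' S ⊆ T := by
      intro i hi
      obtain ⟨j, hj, e⟩ := hST hi
      rwa [← f.injective e]
    have := hT.2 hS h1
    rintro _ ⟨i, hi, rfl⟩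
    exact this hi

theorem unmixed_push (k : Type) [Field k] {τ σ : Type} [Finite σ] [Finite τ] (f : τ ↪ σ)
    (G : Set (Finset τ)) (h : UnmixedIdeal (sqSpan k (pushFam f G))) :
    UnmixedIdeal (sqSpan k G) := by
  rw [unmixed_iff] at h ⊢
  intro S T hS hT
  have := h _ _ (minimal_push f G S hS) (minimal_push f G T hT)
  rwa [f.injective.encard_image, f.injective.encard_image] at this

theorem unmixed_insert (k : Type) [Field k] {σ : Type} [Finite σ] (y : σ)
    (F : Set (Finset σ)) (hF : ∀ s ∈ F, y ∉ s) (h : UnmixedIdeal (sqSpan k F)) :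
    UnmixedIdeal (sqSpan k (F ∪ {{y}})) := by
  rw [unmixed_iff] at h ⊢
  have key : ∀ T, Minimal (Hits (F ∪ {{y}})) T → y ∈ T ∧ Minimal (Hits F) (T \ {y}) := by
    intro T hT
    have hy : y ∈ T := by
      obtain ⟨i, hi, hiT⟩ := hT.1 {y} (.inr rfl)
      rw [Finset.mem_singleton] at hi
      rwa [← hi]
    refine ⟨hy, ?_, ?_⟩
    · intro s hs
      obtain ⟨i, hi, hiT⟩ := hT.1 s (.inl hs)
      exact ⟨i, hi, hiT, fun e => hF s hs (by rw [Set.mem_singleton_iff] at e; rwa [← e])⟩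
    · intro S hS hST i hi
      have : T ⊆ insert y S := by
        refine hT.2 ?_ ?_
        · rintro s (hs | hs)
          · obtain ⟨i, hi, hiS⟩ := hS s hs
            exact ⟨i, hi, .inr hiS⟩
          · rw [Set.mem_singleton_iff] at hs
            subst hs
            exact ⟨y, by simp, .inl rfl⟩
        · rintro j (rfl | hj)
          · exact hy
          · exact (hST hj).1
      rcases this hi.1 with e | e
      · exact absurd e hi.2
      · exact e
  intro S T hS hT
  obtain ⟨a, a'⟩ := key S hS
  obtain ⟨b, b'⟩ := key T hT
  rw [← Set.encard_sdiff_singleton_add_one a, ← Set.encard_sdiff_singleton_add_one b, h _ _ a' b']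

theorem upMem_push {τ σ : Type} (f : τ ↪ σ) (G : Set (Finset τ)) (s : Finset τ) :
    UpMem (pushFam f G) (s.map f) ↔ UpMem G s := by
  simp [UpMem, pushFam]

theorem mem_dropVar {σ : Type} (y : σ) (s : Finset σ) (i : {x : σ // x ≠ y}) :
    i ∈ dropVar y s ↔ (i : σ) ∈ s := by
  simp [dropVar]

theorem upMem_dropC {σ : Type} (y : σ) (F : Set (Finset σ)) (s : Finset {x : σ // x ≠ y}) :
    UpMem (dropVar y '' CFam y F) s ↔
      UpMem F (insert y (s.map (Function.Embedding.subtype _))) := by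
  simp only [UpMem, CFam, Set.exists_mem_image]
  refine exists_congr fun t => and_congr_right fun _ => ?_
  constructor
  · intro h i hi
    by_cases e : i = y
    · simp [e]
    · have := @h ⟨i, e⟩ (by simp [mem_dropVar, e, hi])
      simp [e, this]
  · rintro h ⟨i, e⟩ hi
    rw [mem_dropVar] at hi
    have := h (Finset.mem_of_mem_erase hi)
    simpa [e] using this

theorem upMem_dropN {σ : Type} (y : σ) (F : Set (Finset σ)) (s : Finset {x : σ // x ≠ y}) :
    UpMem (dropVar y '' NFam y F) s ↔
      UpMem F (s.map (Function.Embedding.subtype _)) := by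
  simp only [UpMem, NFam, Set.exists_mem_image]
  constructor
  · rintro ⟨t, ⟨ht, hy⟩, h⟩
    refine ⟨t, ht, fun i hi => ?_⟩
    have e : i ≠ y := fun e => hy (e ▸ hi)
    have := @h ⟨i, e⟩ (by simp [mem_dropVar, hi])
    simp [e, this]
  · rintro ⟨t, ht, h⟩
    refine ⟨t, ⟨ht, fun hy => by simpa using h hy⟩, ?_⟩
    rintro ⟨i, e⟩ hi
    rw [mem_dropVar] at hi
    simpa [e] using h hi

theorem upMem_push' {τ σ : Type} (f : τ ↪ σ) (G : Set (Finset τ)) (s : Finset σ) :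
    UpMem (pushFam f G) s ↔ UpMem G (s.preimage f f.injective.injOn) := by
  simp only [UpMem, pushFam, Set.exists_mem_image]
  refine exists_congr fun t => and_congr_right fun _ => ?_
  rw [Finset.map_subset_iff_subset_preimage]

theorem isGVD_pull (k : Type) [Field k] (σ : Type) (I : Ideal (MvPolynomial σ k))
    (hI : IsGVD k σ I) : ∀ [Finite σ] (τ : Type) (f : τ ↪ σ) (G : Set (Finset τ)),
      I = sqSpan k (pushFam f G) → IsGVD k τ (sqSpan k G) := by
  induction hI with
  | base σ I hunm h =>
    intro _ τ f G hG
    have : Finite τ := Finite.of_injective f f.injective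
    subst hG
    refine IsGVD.base _ _ (unmixed_push k f G hunm) ?_
    rcases h with h | ⟨W, h⟩
    · left
      rw [sqSpan_top] at h ⊢
      obtain ⟨s, hs, e⟩ := h
      rw [Finset.map_eq_empty] at e
      rwa [← e]
    · right
      refine ⟨f ⁻¹' W, ?_⟩
      change _ = varIdeal k _ at h ⊢
      rw [varIdeal_eq, sqSpan_eq_iff] at h ⊢
      intro s
      rw [← upMem_push f, h]
      simp [UpMem]
  | step σ I hunm F hgen y hdec hC hN ihC ihN =>
    intro _ τ f G hG
    have : Finite τ := Finite.of_injective f f.injective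
    have hFG := (sqSpan_eq_iff k _ _).1 (hgen.symm.trans hG)
    by_cases hy : y ∈ Set.range f
    · obtain ⟨t, rfl⟩ := hy
      let g : {x : τ // x ≠ t} ↪ {x : σ // x ≠ f t} :=
        ⟨fun x => ⟨f x, fun e => x.2 (f.injective e)⟩, fun a b e =>
          Subtype.ext (f.injective (congrArg Subtype.val e))⟩
      refine IsGVD.step _ _ (unmixed_push k f G (hG ▸ hunm)) G rfl t (sqSpan_decomp k t G)
        (ihC _ g _ ?_) (ihN _ g _ ?_)
      · rw [sqSpan_eq_iff]
        intro s
        rw [upMem_dropC, hFG, upMem_push', upMem_push', upMem_dropC]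
        refine iff_of_eq (congrArg _ ?_)
        ext i
        by_cases e : i = t <;> simp [e, g] <;> rfl
      · rw [sqSpan_eq_iff]
        intro s
        rw [upMem_dropN, hFG, upMem_push', upMem_push', upMem_dropN]
        refine iff_of_eq (congrArg _ ?_)
        ext i
        by_cases e : i = t <;> simp [e, g] <;> rfl
    · let g : τ ↪ {x : σ // x ≠ y} :=
        ⟨fun x => ⟨f x, fun e => hy ⟨x, e⟩⟩, fun a b e =>
          f.injective (congrArg Subtype.val e)⟩
      refine ihN _ g _ ?_
      rw [sqSpan_eq_iff]
      intro s
      rw [upMem_dropN, hFG, upMem_push', upMem_push']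
      refine iff_of_eq (congrArg _ ?_)
      ext i
      have : f i ≠ y := fun e => hy ⟨i, e⟩
      simp [g, this]
      rfl

theorem unmixed_of_isGVD (k : Type) [Field k] (σ : Type) (I : Ideal (MvPolynomial σ k))
    (hI : IsGVD k σ I) : UnmixedIdeal I := by
  cases hI <;> assumption

/-- **Corollary**: if `m_1, …, m_k` are squarefree monomials in `k[x_1, …, x_n, y]`
none of which is divisible by `y`, and `I = ⟨m_1, …, m_k⟩` is geometrically vertex
decomposable, then so is `J = I + ⟨y⟩`.  (The variables are indexed by
`Option (Fin n)`, with `y` the variable indexed by `none`.) -/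
theorem sqSpan_sup_var_isGVD (k : Type) [Field k] (n : ℕ)
    (F : Finset (Finset (Option (Fin n)))) (hF : ∀ s ∈ F, none ∉ s)
    (hI : IsGVD k (Option (Fin n)) (sqSpan k (↑F : Set (Finset (Option (Fin n)))))) :
    IsGVD k (Option (Fin n))
      (sqSpan k (↑F : Set (Finset (Option (Fin n)))) ⊔
        Ideal.span {MvPolynomial.X (none : Option (Fin n))}) := by
  rw [span_X_eq, sqSpan_sup]
  have hF' : ∀ s ∈ (↑F : Set (Finset (Option (Fin n)))), none ∉ s := fun s hs => hF s hs
  generalize (↑F : Set (Finset (Option (Fin n)))) = H at hI hF'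
  refine IsGVD.step _ _ (unmixed_insert k none H hF' (unmixed_of_isGVD k _ _ hI)) _ rfl none
    (sqSpan_decomp k _ _) ?_ ?_
  · have : sqSpan k (dropVar none '' CFam none (H ∪ {{none}})) = ⊤ := by
      rw [sqSpan_top]
      exact ⟨∅, ⟨{none}, .inr rfl, by simp⟩, by ext i; simp [mem_dropVar]⟩
    rw [this]
    refine IsGVD.base _ _ ?_ (.inl rfl)
    intro P Q hP
    exact absurd (top_le_iff.1 hP.1.2) hP.1.1.ne_top
  · refine isGVD_pull k _ _ hI _ (Function.Embedding.subtype _) _ ?_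
    rw [sqSpan_eq_iff]
    intro s
    rw [upMem_push', upMem_dropN]
    constructor
    · rintro ⟨t, ht, h⟩
      refine ⟨t, .inl ht, fun i hi => ?_⟩
      have e : i ≠ none := fun e => hF' t ht (e ▸ hi)
      simp [e, h hi]
    · rintro ⟨t, ht | ht, h⟩
      · refine ⟨t, ht, fun i hi => ?_⟩
        have := h hi
        simp at this
        exact this.1
      · rw [Set.mem_singleton_iff] at ht
        subst ht
        have := h (Finset.mem_singleton_self _)
        simp at this
end

section
/- Let T be a finite TD-unmixed balanced tree of height 0 or height 1. Then the odd-open neighborhood ideal N_odd(T) over a field k is geometrically vertex decomposable. -/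
open scoped Classical

section GraphDefs

variable {V : Type} (G : SimpleGraph V)

/-- A leaf is a vertex of degree 1. -/
def IsLeafVx (v : V) : Prop := (G.neighborSet v).ncard = 1

/-- The height of a vertex: the minimum distance to a leaf in its connected
component (`0` if there is no leaf reachable from it, e.g. for isolated vertices). -/
noncomputable def heightVx (v : V) : ℕ :=
  sInf {n | ∃ l, IsLeafVx G l ∧ G.Reachable v l ∧ G.dist v l = n}

/-- The height of a graph: the maximum height of a vertex. -/
noncomputable def heightGr : ℕ := sSup (Set.range (heightVx G))

/-- A graph is balanced if no two adjacent vertices have the same height. -/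
def IsBalanced : Prop := ∀ u w, G.Adj u w → heightVx G u ≠ heightVx G w

/-- The open neighborhood of a set of vertices. -/
def nbhd (S : Set V) : Set V := {u | ∃ v ∈ S, G.Adj v u}

/-- A total dominating set: `N(S) = V`. -/
def IsTDSet (S : Set V) : Prop := nbhd G S = Set.univ

/-- A minimal total dominating set. -/
def IsMinTDSet (S : Set V) : Prop := IsTDSet G S ∧ ∀ S' ⊂ S, ¬ IsTDSet G S'

/-- A graph is TD-unmixed if all of its minimal total dominating sets have
the same cardinality. -/
def TDUnmixed : Prop :=
  ∀ S₁ S₂ : Set V, IsMinTDSet G S₁ → IsMinTDSet G S₂ → S₁.ncard = S₂.ncard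

/-- A forest is TD-unmixed if every connected component is TD-unmixed. -/
def ComponentwiseTDUnmixed : Prop :=
  ∀ c : G.ConnectedComponent, TDUnmixed (G.induce c.supp)

end GraphDefs

section ONIDefs

variable {V : Type} [Fintype V]

/-- The open neighborhood of a vertex, as a finset. -/
noncomputable def nbrFinset (G : SimpleGraph V) (v : V) : Finset V :=
  (Set.toFinite (G.neighborSet v)).toFinset

/-- The odd-open neighborhood ideal of a (balanced) graph: generated by the monomials
`X_{N(v)}` for the vertices `v` of odd height. -/
noncomputable def oddONI (k : Type) [Field k] (G : SimpleGraph V) : Ideal (MvPolynomial V k) :=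
  sqSpan k {s | ∃ v : V, Odd (heightVx G v) ∧ s = nbrFinset G v}

end ONIDefs

section Helpers

lemma sqSpan_singleton (k : Type) [Field k] {σ : Type} (s : Finset σ) :
    sqSpan k {s} = Ideal.span {sqMono k s} := by
  unfold sqSpan
  congr 1
  ext m
  simp

lemma sqSpan_empty (k : Type) [Field k] {σ : Type} :
    sqSpan k (∅ : Set (Finset σ)) = ⊥ := by
  simp [sqSpan]

lemma isGVD_bot (k : Type) [Field k] (σ : Type) : IsGVD k σ ⊥ := by
  refine IsGVD.base σ ⊥ ?_ (Or.inr ⟨∅, by simp⟩)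
  intro P Q hP hQ
  have h : (⊥ : Ideal (MvPolynomial σ k)).minimalPrimes = {⊥} :=
    Ideal.minimalPrimes_eq_subsingleton_self
  have h1 : P = ⊥ := by rw [h] at hP; exact hP
  have h2 : Q = ⊥ := by rw [h] at hQ; exact hQ
  subst h1; subst h2; rfl

lemma sqMono_ne_zero (k : Type) [Field k] {σ : Type} (s : Finset σ) : sqMono k s ≠ 0 := by
  unfold sqMono
  rw [Finset.prod_ne_zero_iff]
  intro i _
  exact MvPolynomial.X_ne_zero i

lemma unmixed_principal (k : Type) [Field k] {σ : Type} [Finite σ] (f : MvPolynomial σ k)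
    (hf : f ≠ 0) : UnmixedIdeal (Ideal.span {f}) := by
  have key : ∀ P : Ideal (MvPolynomial σ k), ∀ hP : P ∈ (Ideal.span {f}).minimalPrimes,
      primeHt P hP.1.1 = 1 := by
    intro P hP
    have e : primeHt P hP.1.1 = P.height :=
      (PrimeSpectrum.height_eq_orderHeight (⟨P, hP.1.1⟩ : PrimeSpectrum _)).symm
    rw [e]
    apply le_antisymm
    · exact Ideal.height_le_one_of_isPrincipal_of_mem_minimalPrimes _ P hP
    · rw [Order.one_le_iff_ne_zero, Ne, Ideal.height_eq_zero_iff_eq_bot]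
      rintro rfl
      have := hP.1.2 (Ideal.mem_span_singleton_self f)
      exact hf (by simpa using this)
  intro P Q hP hQ
  rw [key P hP, key Q hQ]

lemma isGVD_principal (k : Type) [Field k] (n : ℕ) : ∀ (σ : Type) [Finite σ] (s : Finset σ),
    s.card = n → IsGVD k σ (sqSpan k {s}) := by
  induction n with
  | zero =>
    intro σ _ s hs
    rw [Finset.card_eq_zero] at hs
    subst hs
    have htop : sqSpan k {(∅ : Finset σ)} = ⊤ := by
      rw [sqSpan_singleton]; simp [sqMono]
    refine IsGVD.base σ _ ?_ (Or.inl htop)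
    rw [sqSpan_singleton]
    exact unmixed_principal k _ (sqMono_ne_zero k _)
  | succ n ih =>
    intro σ _ s hs
    obtain ⟨y, hy⟩ : s.Nonempty := by rw [← Finset.card_pos]; omega
    have hC : CFam y {s} = {s.erase y} := by simp [CFam]
    have hN : NFam y {s} = ∅ := by
      ext t; simp only [NFam, Set.mem_setOf_eq, Set.mem_singleton_iff, Set.mem_empty_iff_false,
        iff_false, not_and, not_not]
      rintro rfl; exact hy
    refine IsGVD.step σ _ ?_ {s} rfl y ?_ ?_ ?_
    · rw [sqSpan_singleton]
      exact unmixed_principal k _ (sqMono_ne_zero k _)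
    · rw [hC, hN, sqSpan_empty, sqSpan_singleton, sqSpan_singleton, bot_sup_eq]
      have hmul : sqMono k s = sqMono k (s.erase y) * MvPolynomial.X y := by
        unfold sqMono; rw [Finset.prod_erase_mul _ _ hy]
      ext g
      rw [Ideal.mem_inf, Ideal.mem_span_singleton, Ideal.mem_span_singleton,
        Ideal.mem_span_singleton, hmul]
      constructor
      · intro h
        exact ⟨(dvd_mul_right _ _).trans h, (dvd_mul_left _ _).trans h⟩
      · rintro ⟨⟨q, rfl⟩, h2⟩
        have hp : Prime (MvPolynomial.X y : MvPolynomial σ k) := MvPolynomial.X_prime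
        rcases hp.dvd_or_dvd h2 with h | h
        · exfalso
          unfold sqMono at h
          obtain ⟨i, hi, hd⟩ := hp.exists_mem_finset_dvd h
          rw [MvPolynomial.X_dvd_X] at hd
          simp_all
        · exact mul_dvd_mul_left _ h
    · rw [hC, Set.image_singleton]
      apply ih
      unfold dropVar
      rw [Finset.card_subtype, Finset.filter_true_of_mem]
      · rw [Finset.card_erase_of_mem hy]; omega
      · intro x hx; exact Finset.ne_of_mem_erase hx
    · rw [hN, Set.image_empty, sqSpan_empty]
      exact isGVD_bot k _

lemma heightVx_le_one {V : Type} [Fintype V] (G : SimpleGraph V)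
    (hht : heightGr G = 0 ∨ heightGr G = 1) (v : V) : heightVx G v ≤ 1 := by
  have h : heightVx G v ≤ heightGr G :=
    le_csSup (Set.finite_range _).bddAbove (Set.mem_range_self v)
  omega

/-- A balanced tree of height at most one has at most one vertex of odd height. -/
lemma odd_unique {V : Type} [Fintype V] (G : SimpleGraph V) (hconn : G.Connected)
    (hbal : IsBalanced G) (hht : heightGr G = 0 ∨ heightGr G = 1) (v w : V)
    (hv : Odd (heightVx G v)) (hw : Odd (heightVx G w)) : w = v := by
  have hle := heightVx_le_one G hht
  have hv1 : heightVx G v = 1 := by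
    have := hle v; have := hv.pos; omega
  -- there is a leaf
  obtain ⟨l, hl⟩ : ∃ l, IsLeafVx G l := by
    have hne : {n | ∃ l, IsLeafVx G l ∧ G.Reachable v l ∧ G.dist v l = n}.Nonempty := by
      by_contra h
      rw [Set.not_nonempty_iff_eq_empty] at h
      unfold heightVx at hv1
      rw [h] at hv1
      simp at hv1
    obtain ⟨_, l, hl, _⟩ := hne
    exact ⟨l, hl⟩
  have hnb : ∀ u, G.Adj v u → heightVx G u = 0 := by
    intro u hu
    have h1 := hbal v u hu
    have h2 := hle u
    omega
  have hleaf : ∀ u, heightVx G u = 0 → IsLeafVx G u := by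
    intro u hu
    have hne : {n | ∃ l, IsLeafVx G l ∧ G.Reachable u l ∧ G.dist u l = n}.Nonempty :=
      ⟨_, l, hl, hconn.preconnected u l, rfl⟩
    have hmem := Nat.sInf_mem hne
    obtain ⟨l', hl', hr, hd⟩ := hmem
    change _ = heightVx G u at hd
    rw [hu, hr.dist_eq_zero_iff] at hd
    rw [hd]; exact hl'
  have hcl : ∀ x, G.Reachable v x → x = v ∨ G.Adj v x := by
    intro x hx
    rw [SimpleGraph.reachable_iff_reflTransGen] at hx
    induction hx with
    | refl => exact Or.inl rfl
    | tail _ hbc ih =>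
      rename_i b c _
      rcases ih with rfl | hb
      · exact Or.inr hbc
      · left
        have h1 := hleaf b (hnb b hb)
        unfold IsLeafVx at h1
        rw [Set.ncard_eq_one] at h1
        obtain ⟨a, ha⟩ := h1
        have hc' : c ∈ G.neighborSet b := hbc
        have hv' : v ∈ G.neighborSet b := hb.symm
        rw [ha] at hc' hv'
        rw [hc', hv']
  rcases hcl w (hconn.preconnected v w) with h | h
  · exact h
  · rw [hnb w h] at hw
    exact absurd hw (by decide)

end Helpers

/-- **Lemma**: the odd-open neighborhood ideal of a finite TD-unmixed balanced tree of
height 0 or 1 is geometrically vertex decomposable. -/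
theorem oddONI_isGVD_of_height_le_one (k : Type) [Field k] {V : Type} [Fintype V]
    (G : SimpleGraph V) (htree : G.IsTree) (hbal : IsBalanced G) (hunm : TDUnmixed G)
    (hht : heightGr G = 0 ∨ heightGr G = 1) :
    IsGVD k V (oddONI k G) := by
  by_cases h : ∃ v, Odd (heightVx G v)
  · obtain ⟨v, hv⟩ := h
    have hs : {s | ∃ v : V, Odd (heightVx G v) ∧ s = nbrFinset G v} = {nbrFinset G v} := by
      ext s
      simp only [Set.mem_setOf_eq, Set.mem_singleton_iff]
      constructor
      · rintro ⟨w, hw, rfl⟩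
        rw [odd_unique G htree.connected hbal hht v w hv hw]
      · rintro rfl; exact ⟨v, hv, rfl⟩
    unfold oddONI
    rw [hs]
    exact isGVD_principal k _ V _ rfl
  · have hs : {s | ∃ v : V, Odd (heightVx G v) ∧ s = nbrFinset G v} = ∅ := by
      ext s
      simp only [Set.mem_setOf_eq, Set.mem_empty_iff_false, iff_false]
      rintro ⟨w, hw, _⟩
      exact h ⟨w, hw⟩
    unfold oddONI
    rw [hs, sqSpan_empty]
    exact isGVD_bot k V
end

section
/- Let T be a finite TD-unmixed balanced tree of height 3, and let u be a vertex of height 2. Then the induced subgraph T∖N[u] is a TD-unmixed balanced forest. -/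
open scoped Classical

/-- Abstract height labelling. -/
structure Lab {V : Type} (G : SimpleGraph V) (h : V → ℕ) : Prop where
  le3 : ∀ v, h v ≤ 3
  adj : ∀ a b, G.Adj a b → h a = h b + 1 ∨ h b = h a + 1
  leaf : ∀ v, h v = 0 → ∀ a b, G.Adj v a → G.Adj v b → a = b
  two : ∀ v, h v ≠ 0 → ∀ a, ∃ b, G.Adj v b ∧ b ≠ a
  down : ∀ v, h v ≠ 0 → ∃ b, G.Adj v b ∧ h v = h b + 1

lemma td_iff {V : Type} {G : SimpleGraph V} {S : Set V} :
    IsTDSet G S ↔ ∀ q, ∃ v ∈ S, G.Adj v q := by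
  simp [IsTDSet, nbhd, Set.eq_univ_iff_forall]

lemma exists_min {V : Type} [Finite V] {G : SimpleGraph V} {B : Set V} (hB : IsTDSet G B) :
    ∃ S, S ⊆ B ∧ IsMinTDSet G S := by
  obtain ⟨S, hSB, hS⟩ := (Set.toFinite {S : Set V | IsTDSet G S}).exists_le_minimal hB
  refine ⟨S, hSB, hS.prop, fun S' hS' ht => ?_⟩
  exact hS'.2 (hS.le_of_le ht hS'.1)

lemma min_le {V : Type} [Finite V] {G : SimpleGraph V} (hu : TDUnmixed G) {S B : Set V}
    (hS : IsMinTDSet G S) (hB : IsTDSet G B) : S.ncard ≤ B.ncard := by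
  obtain ⟨S', hs, hm⟩ := exists_min hB
  rw [hu S S' hS hm]
  exact Set.ncard_le_ncard hs (Set.toFinite _)

lemma min_priv {V : Type} {G : SimpleGraph V} {S : Set V} (hS : IsMinTDSet G S) {a : V}
    (ha : a ∈ S) : ∃ q, G.Adj a q ∧ ∀ b ∈ S, G.Adj b q → b = a := by
  have h1 := hS.2 (S \ {a}) (by
    refine ⟨Set.diff_subset, fun h => ?_⟩
    exact (h ha).2 rfl)
  rw [td_iff] at h1
  push Not at h1
  obtain ⟨q, hq⟩ := h1
  have hq' : ∀ b ∈ S, G.Adj b q → b = a := by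
    intro b hb hbq
    by_contra hne
    exact hq b ⟨hb, hne⟩ hbq
  obtain ⟨b, hb, hbq⟩ := td_iff.1 hS.1 q
  have := hq' b hb hbq
  subst this
  exact ⟨q, hbq, hq'⟩

/-- Structural unmixedness. -/
lemma unm {X : Type} [Finite X] (H : SimpleGraph X) (h : X → ℕ)
    (le3 : ∀ v, h v ≤ 3)
    (adj : ∀ a b, H.Adj a b → h a = h b + 1 ∨ h b = h a + 1)
    (leaf : ∀ v, h v = 0 → ∀ a b, H.Adj v a → H.Adj v b → a = b)
    (one : ∀ v, h v = 1 → ∃ b, H.Adj v b ∧ h b = 0)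
    (two : ∀ v, h v = 2 → ∃ b, H.Adj v b ∧ h b = 1)
    (twou : ∀ v, h v = 2 → ∀ a b, H.Adj v a → H.Adj v b → h a = 1 → h b = 1 → a = b)
    (oneu : ∀ v, h v = 1 → ∀ a b, H.Adj v a → H.Adj v b → h a = 2 → h b = 2 → a = b) :
    TDUnmixed H := by
  suffices key : ∀ S : Set X, IsMinTDSet H S → S.ncard = 2 * {v | h v = 1}.ncard by
    intro S₁ S₂ h1 h2
    rw [key _ h1, key _ h2]
  intro S hS
  have hd := td_iff.1 hS.1
  have hWS : ∀ w, h w = 1 → w ∈ S := by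
    intro w hw
    obtain ⟨l, hl, hl0⟩ := one w hw
    obtain ⟨v, hv, hvl⟩ := hd l
    rwa [leaf l hl0 w v hl.symm hvl.symm]
  have hno3 : ∀ z ∈ S, h z ≠ 3 := by
    intro z hz h3
    obtain ⟨q, hzq, hq⟩ := min_priv hS hz
    have hq2 : h q = 2 := by
      have := adj _ _ hzq; have := le3 q; omega
    obtain ⟨w, hw, hw1⟩ := two q hq2
    have := hq w (hWS w hw1) hw.symm
    subst this; omega
  choose! s hsS hsadj using fun w (_ : h w = 1) => hd w
  have h1 : ∀ e, h e = 0 ∨ h e = 2 → ∀ a b, H.Adj e a → H.Adj e b → h a = 1 → h b = 1 → a = b := by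
    rintro e (he | he) a b ha hb h1 h2
    · exact leaf e he a b ha hb
    · exact twou e he a b ha hb h1 h2
  have hsev : ∀ w, h w = 1 → h (s w) = 0 ∨ h (s w) = 2 := by
    intro w hw
    have := adj _ _ (hsadj w hw); omega
  have inj : Set.InjOn s {v | h v = 1} := by
    intro a ha b hb hab
    refine h1 (s a) (hsev a ha) a b (hsadj a ha) ?_ ha hb
    rw [hab]; exact hsadj b hb
  have hleafdup : ∀ w a b, h w = 1 → a ∈ S → b ∈ S → H.Adj a w → H.Adj b w → h a = 0 → b = a := by
    intro w a b hw ha hb haw hbw h0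
    obtain ⟨q, haq, hq⟩ := min_priv hS ha
    have := leaf a h0 q w haq haw
    subst this
    exact hq b hb hbw
  have huniq : ∀ w a b, h w = 1 → a ∈ S → b ∈ S → H.Adj a w → H.Adj b w → a = b := by
    intro w a b hw ha hb haw hbw
    by_cases ha0 : h a = 0
    · exact (hleafdup w a b hw ha hb haw hbw ha0).symm
    by_cases hb0 : h b = 0
    · exact hleafdup w b a hw hb ha hbw haw hb0
    have := adj _ _ haw
    have := adj _ _ hbw
    exact oneu w hw a b haw.symm hbw.symm (by omega) (by omega)
  have hSeq : S = {v | h v = 1} ∪ s '' {v | h v = 1} := by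
    ext e
    constructor
    · intro he
      by_cases he1 : h e = 1
      · exact Or.inl he1
      right
      have h3 := hno3 e he
      have := le3 e
      have : ∃ w, H.Adj e w ∧ h w = 1 := by
        by_cases h0 : h e = 0
        · obtain ⟨v, hv, hve⟩ := hd e
          have := adj _ _ hve
          exact ⟨v, hve.symm, by omega⟩
        · exact two e (by omega)
      obtain ⟨w, hw, hw1⟩ := this
      exact ⟨w, hw1, huniq w _ _ hw1 (hsS w hw1) he (hsadj w hw1) hw⟩
    · rintro (he | ⟨w, hw, rfl⟩)
      · exact hWS e he
      · exact hsS w hw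
  rw [hSeq, Set.ncard_union_eq ?_ (Set.toFinite _) (Set.toFinite _), Set.ncard_image_of_injOn inj]
  · ring
  · rw [Set.disjoint_left]
    rintro _ ha ⟨w, hw, rfl⟩
    have := hsev w hw
    simp only [Set.mem_setOf_eq] at ha
    omega

/-! Rooted tree facts -/

lemma dist_adj {V : Type} {G : SimpleGraph V} (ht : G.IsTree) (r : V) {a b : V} (hab : G.Adj a b) :
    G.dist r a = G.dist r b + 1 ∨ G.dist r b = G.dist r a + 1 := by
  have h1 := ht.dist_ne_of_adj r hab
  have h2 := hab.diff_dist_adj (u := r)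
  omega

lemma parent_unique {V : Type} {G : SimpleGraph V} (ht : G.IsTree) (r : V) {a b c : V}
    (hac : G.Adj a c) (hbc : G.Adj b c) (ha : G.dist r c = G.dist r a + 1)
    (hb : G.dist r c = G.dist r b + 1) : a = b := by
  obtain ⟨p, hp⟩ := ht.connected.exists_walk_length_eq_dist r a
  obtain ⟨q, hq⟩ := ht.connected.exists_walk_length_eq_dist r b
  have hP : (p.concat hac).IsPath := by
    apply SimpleGraph.Walk.isPath_of_length_eq_dist
    simp [hp, ha]
  have hQ : (q.concat hbc).IsPath := by
    apply SimpleGraph.Walk.isPath_of_length_eq_dist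
    simp [hq, hb]
  have h := ht.isAcyclic.path_unique ⟨_, hP⟩ ⟨_, hQ⟩
  have h := congrArg (fun w => w.1.penultimate) h
  simpa using h

lemma child {V : Type} {G : SimpleGraph V} {h : V → ℕ} (L : Lab G h) (ht : G.IsTree) (r : V) (q : V)
    (hq : h q ≠ 0) : ∃ c, G.Adj q c ∧ G.dist r c = G.dist r q + 1 := by
  obtain ⟨a, ha, -⟩ := L.two q hq q
  obtain ⟨b, hb, hne⟩ := L.two q hq a
  rcases dist_adj ht r ha with h1 | h1
  · rcases dist_adj ht r hb with h2 | h2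
    · exact absurd (parent_unique ht r hb.symm ha.symm h2 h1) hne
    · exact ⟨b, hb, h2⟩
  · exact ⟨a, ha, h1⟩

lemma avoid_td {V : Type} {G : SimpleGraph V} {h : V → ℕ} (L : Lab G h)
    (hex : ∀ v, ∃ b, G.Adj v b) (A : Set V) (hA : ∀ a ∈ A, h a = 2)
    (h3 : ∀ q, h q = 3 → ∃ c, G.Adj q c ∧ c ∉ A) : IsTDSet G Aᶜ := by
  rw [td_iff]
  intro q
  by_cases hq3 : h q = 3
  · obtain ⟨c, hc, hcA⟩ := h3 q hq3
    exact ⟨c, hcA, hc.symm⟩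
  by_cases hq1 : h q = 1
  · obtain ⟨b, hb, h1⟩ := L.down q (by omega)
    refine ⟨b, fun hbA => ?_, hb.symm⟩
    have := hA b hbA; omega
  · obtain ⟨b, hb⟩ := hex q
    refine ⟨b, fun hbA => ?_, hb.symm⟩
    have := hA b hbA
    have := L.adj _ _ hb; omega

lemma lemma1 {V : Type} [Finite V] {G : SimpleGraph V} {h : V → ℕ} (L : Lab G h)
    (ht : G.IsTree) (hex : ∀ v, ∃ b, G.Adj v b) (hu : TDUnmixed G) (u : V) (hu2 : h u = 2)
    (w v : V) (hw : G.Adj u w) (hv : G.Adj u v) (hw1 : h w = 1) (hv1 : h v = 1) : w = v := by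
  by_contra hne
  set A : Set V := {a | h a = 2 ∧ (G.Adj a w ∨ G.Adj a v)} with hAdef
  have dw : G.dist u w = 1 := SimpleGraph.dist_eq_one_iff_adj.2 hw
  have dv : G.dist u v = 1 := SimpleGraph.dist_eq_one_iff_adj.2 hv
  have hB : IsTDSet G Aᶜ := by
    refine avoid_td L hex A (fun a ha => ha.1) fun q hq => ?_
    obtain ⟨c, hc, hd⟩ := child L ht u q (by omega)
    refine ⟨c, hc, ?_⟩
    rintro ⟨hc2, hcw | hcv⟩
    · have := dist_adj ht u hcw
      have := parent_unique ht u hc.symm.symm hcw.symm hd (by omega)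
      subst this; omega
    · have := dist_adj ht u hcv
      have := parent_unique ht u hc.symm.symm hcv.symm hd (by omega)
      subst this; omega
  obtain ⟨S, hSA, hS⟩ := exists_min hB
  have hd := td_iff.1 hS.1
  obtain ⟨a, haS, haw⟩ := hd w
  obtain ⟨b, hbS, hbv⟩ := hd v
  have ha0 : h a = 0 := by
    have := L.adj _ _ haw
    have : h a ≠ 2 := fun h2 => hSA haS ⟨h2, Or.inl haw⟩
    omega
  have hb0 : h b = 0 := by
    have := L.adj _ _ hbv
    have : h b ≠ 2 := fun h2 => hSA hbS ⟨h2, Or.inr hbv⟩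
    omega
  have hab : a ≠ b := by
    rintro rfl
    exact hne (L.leaf a ha0 w v haw hbv)
  have hT : IsTDSet G ((S \ {a, b}) ∪ {u}) := by
    rw [td_iff]
    intro q
    obtain ⟨s, hs, hsq⟩ := hd q
    by_cases hsa : s = a
    · subst hsa
      exact ⟨u, Or.inr rfl, by rw [L.leaf s ha0 q w hsq haw]; exact hw⟩
    by_cases hsb : s = b
    · subst hsb
      exact ⟨u, Or.inr rfl, by rw [L.leaf s hb0 q v hsq hbv]; exact hv⟩
    exact ⟨s, Or.inl ⟨hs, by simp [hsa, hsb]⟩, hsq⟩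
  have hle := min_le hu hS hT
  have h1 := Set.ncard_union_le (S \ {a, b}) {u}
  have h2 := Set.ncard_diff_add_ncard_of_subset (s := {a, b}) (t := S)
    (by rintro x (rfl | rfl) <;> assumption) (Set.toFinite _)
  rw [Set.ncard_pair hab] at h2
  rw [Set.ncard_singleton] at h1
  omega

lemma lemma2 {V : Type} [Finite V] {G : SimpleGraph V} {h : V → ℕ} (L : Lab G h)
    (ht : G.IsTree) (hex : ∀ v, ∃ b, G.Adj v b) (hunm : TDUnmixed G) (w : V) (hw1 : h w = 1)
    (u x : V) (hu : G.Adj w u) (hx : G.Adj w x) (hu2 : h u = 2) (hx2 : h x = 2) : u = x := by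
  by_contra hne
  set d := G.dist w with hddef
  have dadj : ∀ {a b}, G.Adj a b → d a = d b + 1 ∨ d b = d a + 1 := fun hab => dist_adj ht w hab
  have dpar : ∀ {a b c}, G.Adj a c → G.Adj b c → d c = d a + 1 → d c = d b + 1 → a = b :=
    fun h1 h2 h3 h4 => parent_unique ht w h1 h2 h3 h4
  have hchild : ∀ q, h q ≠ 0 → ∃ c, G.Adj q c ∧ d c = d q + 1 := fun q hq => child L ht w q hq
  have du1 : d u = 1 := SimpleGraph.dist_eq_one_iff_adj.2 hu
  have dx1 : d x = 1 := SimpleGraph.dist_eq_one_iff_adj.2 hx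
  have d0 : d w = 0 := SimpleGraph.dist_self
  have d1 : ∀ a, d a = 1 → G.Adj w a := fun a ha => SimpleGraph.dist_eq_one_iff_adj.1 ha
  set Z : Set V := {z | h z = 3 ∧ d z = 2} with hZ
  have hy : ∀ z, z ∈ Z → ∃ y, G.Adj z y ∧ d y = 3 ∧ h y = 2 := by
    rintro z ⟨h3, h2⟩
    obtain ⟨c, hc, hdc⟩ := hchild z (by omega)
    have := L.adj _ _ hc
    have := L.le3 c
    exact ⟨c, hc, by omega, by omega⟩
  choose! y hyadj hyd hyh using hy
  have hw' : ∀ z, z ∈ Z → ∃ v, G.Adj (y z) v ∧ d v = 4 ∧ h v = 1 := by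
    intro z hz
    have e1 := hyd z hz
    have e2 := hyh z hz
    obtain ⟨v, hv, hh⟩ := L.down (y z) (by omega)
    refine ⟨v, hv, ?_, by omega⟩
    rcases dadj hv with h4 | h4
    · have := dpar hv.symm (hyadj z hz) h4 (by have := hz.2; omega)
      subst this
      have := hz.1; omega
    · omega
  choose! k hkadj hkd hkh using hw'
  set A : Set V := {a | h a = 2 ∧ (d a = 3 ∧ (∃ z ∈ Z, G.Adj z a) ∨
    d a = 5 ∧ ∃ z ∈ Z, G.Adj (k z) a)} with hA
  have hyA : ∀ z ∈ Z, y z ∈ A := fun z hz => ⟨hyh z hz, Or.inl ⟨hyd z hz, z, hz, hyadj z hz⟩⟩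
  have hB : IsTDSet G Aᶜ := by
    refine avoid_td L hex A (fun a ha => ha.1) fun q hq => ?_
    by_cases hqZ : q ∈ Z
    · -- its parent
      have hq2 := hqZ.2
      obtain ⟨p, hp, hpd⟩ : ∃ p, G.Adj q p ∧ d p = 1 := by
        obtain ⟨p, hp⟩ := ht.connected.exists_walk_length_eq_dist q w
        rw [SimpleGraph.dist_comm] at hp
        cases p with
        | nil => simp at hp; omega
        | @cons _ m _ ha p' =>
          refine ⟨m, ha, ?_⟩
          have h1 : G.dist m w ≤ p'.length := SimpleGraph.dist_le _
          rw [SimpleGraph.dist_comm] at h1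
          have h2 : p'.length + 1 = d q := by simpa using hp
          have h3 := dadj ha
          change d m ≤ _ at h1
          omega
      refine ⟨p, hp, ?_⟩
      rintro ⟨-, ⟨h3, -⟩ | ⟨h3, -⟩⟩ <;> omega
    · obtain ⟨c, hc, hdc⟩ := hchild q (by omega)
      refine ⟨c, hc, ?_⟩
      rintro ⟨-, ⟨h3, z, hz, hzc⟩ | ⟨h3, z, hz, hzc⟩⟩
      · exact hqZ ⟨hq, by omega⟩
      · have := dpar hc hzc hdc (by rw [hkd z hz]; omega)
        subst this
        have := hkh z hz
        omega
  obtain ⟨S, hSA, hS⟩ := exists_min hB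
  have hd := td_iff.1 hS.1
  have hP : ∀ p, G.Adj w p → h p = 2 → p ∈ S := by
    intro p hp hp2
    obtain ⟨z, hz, hzw⟩ := L.two p (by omega) w
    have hz3 : h z = 3 := by
      rcases L.adj _ _ hz with h1 | h1
      · exact absurd (lemma1 L ht hex hunm p hp2 z w hz hp.symm (by omega) hw1) hzw
      · omega
    have dp : d p = 1 := SimpleGraph.dist_eq_one_iff_adj.2 hp
    have hzd : d z = 2 := by
      rcases dadj hz with h1 | h1
      · exact absurd (dpar hz.symm hp h1 (by omega)) hzw
      · omega
    obtain ⟨s, hs, hsz⟩ := hd z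
    have hs2 : h s = 2 := by
      have := L.adj _ _ hsz
      have := L.le3 s
      omega
    rcases dadj hsz with h1 | h1
    · exact absurd ⟨hs2, Or.inl ⟨by omega, z, ⟨hz3, hzd⟩, hsz.symm⟩⟩ (hSA hs)
    · rwa [dpar hz hsz (by omega) h1]
  obtain ⟨l, hl, hl0⟩ := L.down w (by omega)
  choose! s hsS hsadj using fun z (_ : z ∈ Z) => hd (k z)
  have hs0 : ∀ z ∈ Z, h (s z) = 0 := by
    intro z hz
    have h1 := L.adj _ _ (hsadj z hz)
    have h2 := hkh z hz
    have h3 := hkd z hz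
    by_contra hc
    have hh : h (s z) = 2 := by omega
    apply hSA (hsS z hz)
    rcases dadj (hsadj z hz) with h4 | h4
    · exact ⟨hh, Or.inr ⟨by omega, z, hz, (hsadj z hz).symm⟩⟩
    · rw [dpar (hsadj z hz) (hkadj z hz) h4 (by rw [hyd z hz]; omega)]
      exact hyA z hz
  have kinj : Set.InjOn k Z := by
    intro a ha b hb hab
    have h1 : y a = y b := by
      refine dpar (c := k a) (hkadj a ha) (by rw [hab]; exact hkadj b hb) ?_ ?_
      · rw [hkd a ha, hyd a ha]
      · rw [hkd a ha, hyd b hb]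
    refine dpar (c := y a) (hyadj a ha) (by rw [h1]; exact hyadj b hb) ?_ ?_
    · rw [hyd a ha, ha.2]
    · rw [hyd a ha, hb.2]
  have sinj : Set.InjOn s Z := by
    intro a ha b hb hab
    apply kinj ha hb
    refine L.leaf (s a) (hs0 a ha) _ _ (hsadj a ha) ?_
    rw [hab]; exact hsadj b hb
  have hPd : ∀ p, G.Adj w p → h p = 2 → ∀ q, G.Adj p q → q = w ∨ q ∈ Z := by
    intro p hp hp2 q hq
    by_cases hqw : q = w
    · exact Or.inl hqw
    right
    have dp : d p = 1 := SimpleGraph.dist_eq_one_iff_adj.2 hp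
    refine ⟨?_, ?_⟩
    · rcases L.adj _ _ hq with h1 | h1
      · exact absurd (lemma1 L ht hex hunm p hp2 q w hq hp.symm (by omega) hw1) hqw
      · omega
    · rcases dadj hq with h1 | h1
      · exact absurd (dpar hq.symm hp h1 (by omega)) hqw
      · omega
  have hT : IsTDSet G ((S \ ({u, x} ∪ s '' Z)) ∪ (y '' Z ∪ {l})) := by
    rw [td_iff]
    have hfix : ∀ q, q = w ∨ q ∈ Z → ∃ v ∈ (S \ ({u, x} ∪ s '' Z)) ∪ (y '' Z ∪ {l}), G.Adj v q := by
      rintro q (rfl | hq)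
      · exact ⟨l, Or.inr (Or.inr rfl), hl.symm⟩
      · exact ⟨y q, Or.inr (Or.inl ⟨q, hq, rfl⟩), (hyadj q hq).symm⟩
    intro q
    obtain ⟨t, htS, htq⟩ := hd q
    by_cases htu : t = u
    · subst htu; exact hfix q (hPd _ hu hu2 q htq)
    by_cases htx : t = x
    · subst htx; exact hfix q (hPd _ hx hx2 q htq)
    by_cases hts : t ∈ s '' Z
    · obtain ⟨z, hz, rfl⟩ := hts
      refine ⟨y z, Or.inr (Or.inl ⟨z, hz, rfl⟩), ?_⟩
      rw [L.leaf _ (hs0 z hz) q (k z) htq (hsadj z hz)]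
      exact hkadj z hz
    · refine ⟨t, Or.inl ⟨htS, ?_⟩, htq⟩
      rintro ((h1 | h1) | h1)
      · exact htu h1
      · exact htx h1
      · exact hts h1
  have hle := min_le hunm hS hT
  have h1 := Set.ncard_union_le (S \ ({u, x} ∪ s '' Z)) (y '' Z ∪ {l})
  have h2 := Set.ncard_diff_add_ncard_of_subset (s := {u, x} ∪ s '' Z) (t := S)
    (by
      rintro t ((rfl | rfl) | ⟨z, hz, rfl⟩)
      · exact hP _ hu hu2
      · exact hP _ hx hx2
      · exact hsS z hz) (Set.toFinite _)
  have h3 := Set.ncard_union_le (y '' Z) {l}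
  have h4 := Set.ncard_image_le (f := y) (Set.toFinite Z)
  have h5 : ({u, x} ∪ s '' Z : Set V).ncard = 2 + Z.ncard := by
    rw [Set.ncard_union_eq ?_ (Set.toFinite _) (Set.toFinite _), Set.ncard_pair hne,
      Set.ncard_image_of_injOn sinj]
    rw [Set.disjoint_left]
    rintro _ ha ⟨z, hz, rfl⟩
    have h0 := hs0 z hz
    rcases ha with ha | ha
    · rw [ha] at h0; omega
    · rw [Set.mem_singleton_iff] at ha; rw [ha] at h0; omega
  rw [Set.ncard_singleton] at h3
  omega

/-! Heights give a labelling -/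

lemma height_le {V : Type} {G : SimpleGraph V} {v l : V} (hl : IsLeafVx G l)
    (hr : G.Reachable v l) : heightVx G v ≤ G.dist v l :=
  Nat.sInf_le ⟨l, hl, hr, rfl⟩

lemma height_mem {V : Type} {G : SimpleGraph V} {v l : V} (hl : IsLeafVx G l)
    (hr : G.Reachable v l) :
    ∃ l, IsLeafVx G l ∧ G.Reachable v l ∧ G.dist v l = heightVx G v :=
  Nat.sInf_mem (s := {n | ∃ l, IsLeafVx G l ∧ G.Reachable v l ∧ G.dist v l = n})
    ⟨_, l, hl, hr, rfl⟩

lemma leaf_iff {V : Type} {G : SimpleGraph V} {v : V} :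
    IsLeafVx G v ↔ ∃ a, G.Adj v a ∧ ∀ b, G.Adj v b → b = a := by
  unfold IsLeafVx
  rw [Set.ncard_eq_one]
  constructor
  · rintro ⟨a, ha⟩
    refine ⟨a, ?_, fun b hb => ?_⟩
    · change a ∈ G.neighborSet v
      rw [ha]; rfl
    · have : b ∈ G.neighborSet v := hb
      rw [ha] at this; exact this
  · rintro ⟨a, ha, hb⟩
    refine ⟨a, Set.ext fun b => ⟨fun h => hb b h, ?_⟩⟩
    rintro rfl; exact ha

lemma lab_height {V : Type} [Fintype V] (G : SimpleGraph V)
    (htree : G.IsTree) (hbal : IsBalanced G) (hht : heightGr G = 3) (l₀ : V)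
    (hl₀ : IsLeafVx G l₀) : Lab G (heightVx G) := by
  have hc := htree.connected
  have hm : ∀ v, ∃ l, IsLeafVx G l ∧ G.dist v l = heightVx G v := by
    intro v
    obtain ⟨l, h1, -, h2⟩ := height_mem hl₀ (hc v l₀)
    exact ⟨l, h1, h2⟩
  have hstep : ∀ a b, G.Adj a b → heightVx G a ≤ heightVx G b + 1 := by
    intro a b hab
    obtain ⟨l, h1, h2⟩ := hm b
    have h3 := height_le h1 (hc a l)
    have h4 := hc.dist_triangle (u := a) (v := b) (w := l)
    have h5 : G.dist a b = 1 := SimpleGraph.dist_eq_one_iff_adj.2 hab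
    omega
  have hdown : ∀ v, heightVx G v ≠ 0 → ∃ b, G.Adj v b ∧ heightVx G v = heightVx G b + 1 := by
    intro v hv
    obtain ⟨l, h1, h2⟩ := hm v
    obtain ⟨p, hp⟩ := hc.exists_walk_length_eq_dist v l
    cases p with
    | nil => simp at h2; omega
    | @cons _ m _ ha p' =>
      refine ⟨m, ha, ?_⟩
      have h3 : G.dist m l ≤ p'.length := SimpleGraph.dist_le _
      have h4 : p'.length + 1 = G.dist v l := by simpa using hp
      have h5 := height_le h1 (hc m l)
      have h6 := hstep _ _ ha
      omega
  refine ⟨?_, ?_, ?_, ?_, hdown⟩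
  · intro v
    rw [← hht]
    exact le_csSup (Set.finite_range _).bddAbove ⟨v, rfl⟩
  · intro a b hab
    have h1 := hbal a b hab
    have h2 := hstep a b hab
    have h3 := hstep b a hab.symm
    omega
  · intro v hv a b ha hb
    obtain ⟨l, h1, h2⟩ := hm v
    have : v = l := hc.dist_eq_zero_iff.1 (by omega)
    subst this
    obtain ⟨c, -, hcc⟩ := leaf_iff.1 h1
    rw [hcc a ha, hcc b hb]
  · intro v hv a
    by_contra hcon
    push Not at hcon
    obtain ⟨b, hb, -⟩ := hdown v hv
    have hlf : IsLeafVx G v := leaf_iff.2 ⟨a, by rw [← hcon b hb]; exact hb, hcon⟩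
    have := height_le hlf (hc v v)
    simp at this
    omega

lemma walk_parity {V : Type} {G : SimpleGraph V} {h : V → ℕ}
    (adj : ∀ a b, G.Adj a b → h a = h b + 1 ∨ h b = h a + 1) {a b : V} (p : G.Walk a b) :
    p.length % 2 = (h a + h b) % 2 := by
  induction p with
  | nil => simp; omega
  | cons ha p ih =>
    have := adj _ _ ha
    simp only [SimpleGraph.Walk.length_cons]
    omega


/-- **Theorem**: if `T` is a finite TD-unmixed balanced tree of height 3 and `u` is a
vertex of height 2, then the induced subgraph `T∖N[u]` is a TD-unmixed balanced forest. -/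
theorem delete_closed_neighborhood {V : Type} [Fintype V] (G : SimpleGraph V)
    (htree : G.IsTree) (hbal : IsBalanced G) (hunm : TDUnmixed G)
    (hht : heightGr G = 3) (u : V) (hu : heightVx G u = 2) :
    (G.induce ((G.neighborSet u ∪ {u})ᶜ)).IsAcyclic ∧
      IsBalanced (G.induce ((G.neighborSet u ∪ {u})ᶜ)) ∧
      ComponentwiseTDUnmixed (G.induce ((G.neighborSet u ∪ {u})ᶜ)) := by
  have hv₃ : ∃ v, heightVx G v ≠ 0 := ⟨u, by omega⟩
  obtain ⟨l₀, hl₀⟩ : ∃ l, IsLeafVx G l := by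
    by_contra hno
    push Not at hno
    have : heightVx G u = 0 := by
      unfold heightVx
      convert Nat.sInf_empty
      ext n
      simp [hno]
    omega
  have L := lab_height G htree hbal hht l₀ hl₀
  have hex : ∀ v, ∃ b, G.Adj v b := by
    have : Nontrivial V := by
      obtain ⟨b, hb, -⟩ := L.down u (by omega)
      exact ⟨u, b, hb.ne⟩
    intro v
    exact htree.connected.preconnected.exists_adj_of_nontrivial v
  have l1 := lemma1 L htree hex hunm
  have l2 := lemma2 L htree hex hunm
  set N : Set V := (G.neighborSet u ∪ {u})ᶜ with hN
  set F := G.induce N with hF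
  let h : N → ℕ := fun v => heightVx G v.1
  have hmem : ∀ v, v ∈ N ↔ ¬ G.Adj u v ∧ v ≠ u := by
    intro v; simp [hN, not_or]; tauto
  have hodd : ∀ v : N, h v = 1 ∨ h v = 3 → ∀ b, G.Adj v.1 b → b ∈ N := by
    intro v hv b hb
    have hv' : heightVx G v.1 = 1 ∨ heightVx G v.1 = 3 := hv
    rw [hmem]
    refine ⟨fun hub => ?_, ?_⟩
    · have h1 := L.adj _ _ hub
      have h2 := L.adj _ _ hb
      omega
    · rintro rfl
      exact ((hmem v.1).1 v.2).1 hb.symm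
  have adj : ∀ a b : N, F.Adj a b → h a = h b + 1 ∨ h b = h a + 1 :=
    fun a b hab => L.adj _ _ hab
  have le3 : ∀ a : N, h a ≤ 3 := fun a => L.le3 a.1
  have leaf : ∀ v : N, h v = 0 → ∀ a b, F.Adj v a → F.Adj v b → a = b :=
    fun v hv a b ha hb => Subtype.ext (L.leaf v.1 hv a.1 b.1 ha hb)
  have one : ∀ v : N, h v = 1 → ∃ b, F.Adj v b ∧ h b = 0 := by
    intro v hv
    have hv' : heightVx G v.1 = 1 := hv
    obtain ⟨b, hb, hb1⟩ := L.down v.1 (by omega)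
    exact ⟨⟨b, hodd v (Or.inl hv) b hb⟩, hb, by change heightVx G b = 0; omega⟩
  have two : ∀ v : N, h v = 2 → ∃ b, F.Adj v b ∧ h b = 1 := by
    intro v hv
    have hv' : heightVx G v.1 = 2 := hv
    obtain ⟨b, hb, hb1⟩ := L.down v.1 (by omega)
    have hvN := (hmem v.1).1 v.2
    refine ⟨⟨b, (hmem b).2 ⟨fun hub => ?_, ?_⟩⟩, hb, by change heightVx G b = 1; omega⟩
    · exact hvN.2 (l2 b (by omega) v.1 u hb.symm hub.symm hv' hu)
    · rintro rfl; omega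
  have twou : ∀ v : N, h v = 2 → ∀ a b, F.Adj v a → F.Adj v b → h a = 1 → h b = 1 → a = b :=
    fun v hv a b ha hb h1 h2 => Subtype.ext (l1 v.1 hv a.1 b.1 ha hb h1 h2)
  have oneu : ∀ v : N, h v = 1 → ∀ a b, F.Adj v a → F.Adj v b → h a = 2 → h b = 2 → a = b :=
    fun v hv a b ha hb h1 h2 => Subtype.ext (l2 v.1 hv a.1 b.1 ha hb h1 h2)
  refine ⟨htree.isAcyclic.induce _, ?_, ?_⟩
  · have hleafeven : ∀ l : N, IsLeafVx F l → h l % 2 = 0 := by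
      intro l hl
      obtain ⟨a, ha, hu'⟩ := leaf_iff.1 hl
      by_contra hcon
      have := le3 l
      have ho : h l = 1 ∨ h l = 3 := by omega
      obtain ⟨b, hb, hba⟩ := L.two l.1 (by change h l ≠ 0; omega) a.1
      exact hba (congrArg Subtype.val (hu' ⟨b, hodd l ho b hb⟩ hb))
    have r1 : ∀ v : N, h v = 1 → ∃ l, IsLeafVx F l ∧ F.Reachable v l := by
      intro v hv
      obtain ⟨l, hl, hl0⟩ := one v hv
      exact ⟨l, leaf_iff.2 ⟨v, hl.symm, fun b hb => leaf l hl0 b v hb hl.symm⟩, hl.reachable⟩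
    have r2 : ∀ v : N, h v = 2 → ∃ l, IsLeafVx F l ∧ F.Reachable v l := by
      intro v hv
      obtain ⟨w, hw, hw1⟩ := two v hv
      obtain ⟨l, hl, hr⟩ := r1 w hw1
      exact ⟨l, hl, hw.reachable.trans hr⟩
    have r12 : ∀ a b : N, F.Adj a b → ∃ l, IsLeafVx F l ∧ F.Reachable a l := by
      intro a b hab
      have h1 := adj a b hab
      have h2 := le3 a
      have h3 := le3 b
      by_cases c1 : h a = 1
      · exact r1 a c1
      by_cases c2 : h a = 2
      · exact r2 a c2
      have : ∃ l, IsLeafVx F l ∧ F.Reachable b l := by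
        by_cases c3 : h b = 1
        · exact r1 b c3
        · exact r2 b (by omega)
      obtain ⟨l, hl, hr⟩ := this
      exact ⟨l, hl, hab.reachable.trans hr⟩
    have par : ∀ a b : N, F.Adj a b → heightVx F a % 2 = h a % 2 := by
      intro a b hab
      obtain ⟨l, hl, hr⟩ := r12 a b hab
      obtain ⟨l', hl', hr', hd⟩ := height_mem hl hr
      obtain ⟨p, hp⟩ := hr'.exists_walk_length_eq_dist
      have h1 := walk_parity (h := h) adj p
      have h2 := hleafeven l' hl'
      omega
    intro a b hab heq
    have h1 := par a b hab
    have h2 := par b a hab.symm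
    have h3 := adj a b hab
    omega
  · intro c
    have cl : ∀ v : c.supp, ∀ b, F.Adj v.1 b → b ∈ c.supp :=
      fun v b hb => (c.mem_supp_congr_adj hb).1 v.2
    refine unm (F.induce c.supp) (fun v => h v.1) (fun v => le3 _) (fun a b hab => adj _ _ hab)
      (fun v hv a b ha hb => Subtype.ext (leaf v.1 hv _ _ ha hb)) ?_ ?_
      (fun v hv a b ha hb h1 h2 => Subtype.ext (twou v.1 hv _ _ ha hb h1 h2))
      (fun v hv a b ha hb h1 h2 => Subtype.ext (oneu v.1 hv _ _ ha hb h1 h2))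
    · intro v hv
      obtain ⟨b, hb, h0⟩ := one v.1 hv
      exact ⟨⟨b, cl v b hb⟩, hb, h0⟩
    · intro v hv
      obtain ⟨b, hb, h0⟩ := two v.1 hv
      exact ⟨⟨b, cl v b hb⟩, hb, h0⟩
end

section
/- Let T be a finite balanced tree. Then T is TD-unmixed if and only if (1) height(T) ≤ 3, (2) for all vertices v of height 2, |N(v) ∩ V_1| = 1, and (3) for all vertices v of height 1, |N(v) ∩ V_2| ≤ 1. Moreover, if T is TD-unmixed and height(T) = 3, then for all vertices v of height 1, |N(v) ∩ V_2| = 1. -/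
open scoped Classical

section Helpers

variable {V : Type} {G : SimpleGraph V}

lemma tdx_iff (S : Set V) : IsTDSet G S ↔ ∀ u, ∃ s ∈ S, G.Adj s u := by
  unfold IsTDSet nbhd
  rw [Set.eq_univ_iff_forall]
  rfl

lemma tdx_exists_min [Fintype V] {R : Set V} (hR : IsTDSet G R) :
    ∃ S ⊆ R, IsMinTDSet G S := by
  obtain ⟨S, hSR, hS⟩ := exists_minimal_le_of_wellFoundedLT (IsTDSet G) R hR
  exact ⟨S, hSR, hS.1, fun S' hS' h => hS'.2 (hS.2 h hS'.1)⟩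

lemma tdx_not_smaller [Fintype V] (hU : TDUnmixed G) {S T : Set V} (hS : IsMinTDSet G S)
    (hT : IsTDSet G T) : S.ncard ≤ T.ncard := by
  obtain ⟨T', hT', hm⟩ := tdx_exists_min hT
  rw [hU S T' hS hm]
  exact Set.ncard_le_ncard hT' (Set.toFinite _)

lemma tdx_parent_unique (ht : G.IsTree) (z : V) {a b c : V} (ha : G.Adj a c) (hb : G.Adj b c)
    (hda : G.dist z c = G.dist z a + 1) (hdb : G.dist z c = G.dist z b + 1) : a = b := by
  obtain ⟨p, hp⟩ := ht.connected.exists_walk_length_eq_dist z a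
  obtain ⟨q, hq⟩ := ht.connected.exists_walk_length_eq_dist z b
  have h1 : (p.concat ha).IsPath :=
    SimpleGraph.Walk.isPath_of_length_eq_dist _ (by rw [SimpleGraph.Walk.length_concat]; omega)
  have h2 : (q.concat hb).IsPath :=
    SimpleGraph.Walk.isPath_of_length_eq_dist _ (by rw [SimpleGraph.Walk.length_concat]; omega)
  have h3 := (ht.existsUnique_path z c).unique h1 h2
  have h4 := congrArg SimpleGraph.Walk.penultimate h3
  simpa using h4

/-- going on without turning back increases the distance to the root -/
lemma tdx_step (ht : G.IsTree) (z : V) {a u c : V} (ha : G.Adj a u) (hc : G.Adj u c)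
    (hne : c ≠ a) (hd : G.dist z u = G.dist z a + 1) : G.dist z c = G.dist z u + 1 := by
  rcases ht.dist_eq_dist_add_one_of_adj z hc with h | h
  · exact absurd (tdx_parent_unique ht z hc.symm ha h hd) hne
  · exact h

/-- the main exchange lemma -/
lemma tdx_exchange [Fintype V] (ht : G.IsTree) (hU : TDUnmixed G) {z w x v l : V}
    (hnb : ∀ u, ∃ c, G.Adj u c)
    (hodd : ∀ u, Odd (G.dist z u) → ∀ a, ∃ c, G.Adj u c ∧ c ≠ a)
    (hzw : G.Adj z w) (hwx : G.Adj w x) (hxv : G.Adj x v) (hvl : G.Adj v l)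
    (hxz : x ≠ z) (hvw : v ≠ w) (hlx : l ≠ x) (hl : ∀ u, G.Adj l u → u = v)
    (hp : ∀ p, G.Adj z p → p ≠ w → ∃ a b, G.Adj p a ∧ a ≠ z ∧ G.Adj a b ∧ b ≠ p) : False := by
  choose! a b hpa haz hab hbp using hp
  have dz : G.dist z z = 0 := SimpleGraph.dist_self
  have dn : ∀ p, G.Adj z p → G.dist z p = 1 := fun p h => SimpleGraph.dist_eq_one_iff_adj.2 h
  have dw : G.dist z w = 1 := dn w hzw
  have dx : G.dist z x = 2 := by rw [tdx_step ht z hzw hwx hxz (by omega)]; omega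
  have dv : G.dist z v = 3 := by rw [tdx_step ht z hwx hxv hvw (by omega)]; omega
  have dl : G.dist z l = 4 := by rw [tdx_step ht z hxv hvl hlx (by omega)]; omega
  have da : ∀ p, G.Adj z p → p ≠ w → G.dist z (a p) = 2 := fun p h h' => by
    have := dn p h
    rw [tdx_step ht z h (hpa p h h') (haz p h h') (by omega)]; omega
  have db : ∀ p, G.Adj z p → p ≠ w → G.dist z (b p) = 3 := fun p h h' => by
    have := dn p h
    have := da p h h'
    rw [tdx_step ht z (hpa p h h') (hab p h h') (hbp p h h') (by omega)]; omega
  have hbv : ∀ p, G.Adj z p → p ≠ w → b p ≠ v := fun p h h' e => by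
    have h1 : a p = x := tdx_parent_unique ht z (hab p h h') (e ▸ hxv)
      (by rw [da p h h', db p h h']) (by rw [dx, db p h h'])
    have h2 : p = w := tdx_parent_unique ht z (hpa p h h') (h1 ▸ hwx)
      (by rw [da p h h', dn p h]) (by rw [dw, da p h h'])
    exact h' h2
  let Sp : V → Prop := fun u => u = w ∨ u = v ∨ ∃ p, G.Adj z p ∧ p ≠ w ∧ u = b p
  let F : Set V := {c | ∃ u, Sp u ∧ G.Adj u c ∧ G.dist z c = G.dist z u + 1 ∧ c ≠ l}
  have hSpd : ∀ u, Sp u → G.dist z u = 1 ∨ G.dist z u = 3 := by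
    rintro u (rfl | rfl | ⟨p, h, h', rfl⟩)
    · exact Or.inl dw
    · exact Or.inr dv
    · exact Or.inr (db p h h')
  have hFd : ∀ c ∈ F, G.dist z c = 2 ∨ G.dist z c = 4 := by
    rintro c ⟨u, hu, _, h, _⟩
    have := hSpd u hu
    omega
  have hzF : z ∉ F := fun h => by have := hFd z h; omega
  have hlF : l ∉ F := by rintro ⟨u, hu, _, _, h⟩; exact h rfl
  have haF : ∀ p, G.Adj z p → p ≠ w → a p ∉ F := by
    rintro p h h' ⟨u, hu, huc, hd, _⟩
    have h1 : p = u := tdx_parent_unique ht z (hpa p h h') huc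
      (by rw [da p h h', dn p h]) hd
    subst h1
    have := dn p h
    rcases hu with hu | hu | ⟨q, hq, hq', hu⟩
    · exact h' hu
    · rw [hu] at this; omega
    · have := db q hq hq'; rw [← hu] at this; omega
  have hR : IsTDSet G Fᶜ := by
    rw [tdx_iff]
    intro u
    rcases Nat.even_or_odd (G.dist z u) with he | ho
    · obtain ⟨c, hc⟩ := hnb u
      refine ⟨c, fun hcF => ?_, hc.symm⟩
      have h1 := hFd c hcF
      have h2 := ht.dist_eq_dist_add_one_of_adj z hc
      rcases he with ⟨k, hk⟩
      omega
    · by_cases hu : Sp u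
      · rcases hu with rfl | rfl | ⟨p, h, h', rfl⟩
        · exact ⟨z, hzF, hzw⟩
        · exact ⟨l, hlF, hvl.symm⟩
        · exact ⟨a p, haF p h h', hab p h h'⟩
      · have hpar : ∃ q, G.Adj q u ∧ ∀ c, G.Adj u c → c ≠ q → G.dist z c = G.dist z u + 1 := by
          by_cases hq : ∃ q, G.Adj q u ∧ G.dist z u = G.dist z q + 1
          · obtain ⟨q, hq, hqd⟩ := hq
            exact ⟨q, hq, fun c hc hcq => tdx_step ht z hq hc hcq hqd⟩
          · obtain ⟨c, hc⟩ := hnb u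
            refine ⟨c, hc.symm, fun c' hc' _ => ?_⟩
            rcases ht.dist_eq_dist_add_one_of_adj z hc' with h | h
            · exact absurd ⟨c', hc'.symm, h⟩ hq
            · exact h
        obtain ⟨q, hq, hqc⟩ := hpar
        obtain ⟨c, hc, hcq⟩ := hodd u ho q
        have hcd := hqc c hc hcq
        refine ⟨c, ?_, hc.symm⟩
        rintro ⟨u', hu', huc, hd, _⟩
        have := tdx_parent_unique ht z hc huc hcd hd
        exact hu (this ▸ hu')
  obtain ⟨S, hSR, hS⟩ := tdx_exists_min hR
  have hSF : ∀ s ∈ S, s ∉ F := fun s hs => hSR hs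
  have hSd := (tdx_iff S).1 hS.1
  have hxF : x ∈ F := ⟨w, Or.inl rfl, hwx, by omega, hlx.symm⟩
  have hzS : z ∈ S := by
    obtain ⟨s, hs, hsw⟩ := hSd w
    by_cases e : s = z
    · exact e ▸ hs
    · have := tdx_step ht z hzw hsw.symm e (by omega)
      refine absurd ⟨w, Or.inl rfl, hsw.symm, this, ?_⟩ (hSF s hs)
      rintro rfl
      omega
  have hlS : l ∈ S := by
    obtain ⟨s, hs, hsv⟩ := hSd v
    by_cases e : s = l
    · exact e ▸ hs
    · by_cases e' : s = x
      · exact absurd (e' ▸ hxF) (hSF s hs)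
      · have := tdx_step ht z hxv hsv.symm e' (by omega)
        exact absurd ⟨v, Or.inr (Or.inl rfl), hsv.symm, this, e⟩ (hSF s hs)
  have haS : ∀ p, G.Adj z p → p ≠ w → a p ∈ S := fun p h h' => by
    obtain ⟨s, hs, hsb⟩ := hSd (b p)
    by_cases e : s = a p
    · exact e ▸ hs
    · have h1 := da p h h'
      have h2 := db p h h'
      have := tdx_step ht z (hab p h h') hsb.symm e (by omega)
      refine absurd ⟨b p, Or.inr (Or.inr ⟨p, h, h', rfl⟩), hsb.symm, this, ?_⟩ (hSF s hs)
      rintro rfl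
      exact hbv p h h' (hl _ hsb)
  have hT : IsTDSet G (insert x (S \ {z, l})) := by
    rw [tdx_iff]
    intro u
    obtain ⟨s, hs, hsu⟩ := hSd u
    by_cases e1 : s = l
    · have : u = v := hl u (e1 ▸ hsu)
      exact ⟨x, Set.mem_insert _ _, this ▸ hxv⟩
    · by_cases e2 : s = z
      · subst e2
        by_cases e3 : u = w
        · exact ⟨x, Set.mem_insert _ _, e3 ▸ hwx.symm⟩
        · refine ⟨a u, Set.mem_insert_of_mem _ ⟨haS u hsu e3, ?_⟩, (hpa u hsu e3).symm⟩
          have := da u hsu e3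
          simp only [Set.mem_insert_iff, Set.mem_singleton_iff]
          rintro (h | h) <;> rw [h] at this <;> omega
      · exact ⟨s, Set.mem_insert_of_mem _ ⟨hs, by simp [e1, e2]⟩, hsu⟩
  have hc := tdx_not_smaller hU hS hT
  have h1 := Set.ncard_insert_le x (S \ {z, l})
  have h2 : (S \ {z, l}).ncard + ({z, l} : Set V).ncard = S.ncard :=
    Set.ncard_sdiff_add_ncard_of_subset (by
      rintro y (rfl | rfl)
      · exact hzS
      · exact hlS) (Set.toFinite _)
  have h3 : ({z, l} : Set V).ncard = 2 := Set.ncard_pair (by rintro rfl; omega)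
  omega

/-- exchange lemma for two support vertices adjacent to `x` -/
lemma tdx_exchange2 [Fintype V] (ht : G.IsTree) (hU : TDUnmixed G) {x v₁ v₂ l₁ l₂ : V}
    (hnb : ∀ u, ∃ c, G.Adj u c)
    (hodd : ∀ u, Odd (G.dist x u) → ∀ a, ∃ c, G.Adj u c ∧ c ≠ a)
    (h1 : G.Adj x v₁) (h2 : G.Adj x v₂) (hne : v₁ ≠ v₂) (hl1 : G.Adj v₁ l₁) (hl2 : G.Adj v₂ l₂)
    (hx1 : l₁ ≠ x) (hx2 : l₂ ≠ x)
    (hu1 : ∀ u, G.Adj l₁ u → u = v₁) (hu2 : ∀ u, G.Adj l₂ u → u = v₂) : False := by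
  have dx : G.dist x x = 0 := SimpleGraph.dist_self
  have dv1 : G.dist x v₁ = 1 := SimpleGraph.dist_eq_one_iff_adj.2 h1
  have dv2 : G.dist x v₂ = 1 := SimpleGraph.dist_eq_one_iff_adj.2 h2
  let R : Set V := {c | ∀ u, u = v₁ ∨ u = v₂ → G.Adj u c → c = l₁ ∨ c = l₂}
  have hxll : ¬ (x = l₁ ∨ x = l₂) := by rintro (h | h) <;> simp_all
  have hl12 : l₁ ≠ l₂ := fun e => hne (hu2 _ (e ▸ hl1.symm))
  have hR : IsTDSet G R := by
    rw [tdx_iff]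
    intro u
    by_cases hu1' : u = v₁
    · exact ⟨l₁, fun _ _ _ => Or.inl rfl, hu1' ▸ hl1.symm⟩
    by_cases hu2' : u = v₂
    · exact ⟨l₂, fun _ _ _ => Or.inr rfl, hu2' ▸ hl2.symm⟩
    rcases Nat.even_or_odd (G.dist x u) with he | ho
    · obtain ⟨c, hc⟩ := hnb u
      refine ⟨c, fun q hq hqc => ?_, hc.symm⟩
      have hd := ht.dist_eq_dist_add_one_of_adj x hc
      have hd' := ht.dist_eq_dist_add_one_of_adj x hqc
      have : G.dist x q = 1 := by rcases hq with rfl | rfl <;> assumption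
      rcases he with ⟨k, hk⟩
      omega
    · have hpar : ∃ q, G.Adj q u ∧ ∀ c, G.Adj u c → c ≠ q → G.dist x c = G.dist x u + 1 := by
        by_cases hq : ∃ q, G.Adj q u ∧ G.dist x u = G.dist x q + 1
        · obtain ⟨q, hq, hqd⟩ := hq
          exact ⟨q, hq, fun c hc hcq => tdx_step ht x hq hc hcq hqd⟩
        · obtain ⟨c, hc⟩ := hnb u
          refine ⟨c, hc.symm, fun c' hc' _ => ?_⟩
          rcases ht.dist_eq_dist_add_one_of_adj x hc' with h | h
          · exact absurd ⟨c', hc'.symm, h⟩ hq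
          · exact h
      obtain ⟨q, hq, hqc⟩ := hpar
      obtain ⟨c, hc, hcq⟩ := hodd u ho q
      have hcd := hqc c hc hcq
      refine ⟨c, fun r hr hrc => ?_, hc.symm⟩
      exfalso
      have hr1 : G.dist x r = 1 := by rcases hr with rfl | rfl <;> assumption
      rcases ht.dist_eq_dist_add_one_of_adj x hrc with h | h
      · omega
      · have : u = r := tdx_parent_unique ht x hc hrc hcd h
        rcases hr with h | h
        · exact hu1' (this.trans h)
        · exact hu2' (this.trans h)
  obtain ⟨S, hSR, hS⟩ := tdx_exists_min hR
  have hSd := (tdx_iff S).1 hS.1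
  have hl1S : l₁ ∈ S := by
    obtain ⟨s, hs, hsv⟩ := hSd v₁
    rcases hSR hs v₁ (Or.inl rfl) hsv.symm with h | h
    · exact h ▸ hs
    · exact absurd (hu2 _ (h ▸ hsv)) hne
  have hl2S : l₂ ∈ S := by
    obtain ⟨s, hs, hsv⟩ := hSd v₂
    rcases hSR hs v₂ (Or.inr rfl) hsv.symm with h | h
    · exact absurd (hu1 _ (h ▸ hsv)).symm hne
    · exact h ▸ hs
  have hT : IsTDSet G (insert x (S \ {l₁, l₂})) := by
    rw [tdx_iff]
    intro u
    obtain ⟨s, hs, hsu⟩ := hSd u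
    by_cases e1 : s = l₁
    · exact ⟨x, Set.mem_insert _ _, (hu1 u (e1 ▸ hsu)) ▸ h1⟩
    · by_cases e2 : s = l₂
      · exact ⟨x, Set.mem_insert _ _, (hu2 u (e2 ▸ hsu)) ▸ h2⟩
      · exact ⟨s, Set.mem_insert_of_mem _ ⟨hs, by simp [e1, e2]⟩, hsu⟩
  have hc := tdx_not_smaller hU hS hT
  have k1 := Set.ncard_insert_le x (S \ {l₁, l₂})
  have k2 : (S \ {l₁, l₂}).ncard + ({l₁, l₂} : Set V).ncard = S.ncard :=
    Set.ncard_sdiff_add_ncard_of_subset (by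
      rintro y (rfl | rfl)
      · exact hl1S
      · exact hl2S) (Set.toFinite _)
  have k3 : ({l₁, l₂} : Set V).ncard = 2 := Set.ncard_pair hl12
  omega

lemma tdx_leaf_unique {l a b : V} (hl : IsLeafVx G l) (ha : G.Adj l a) (hb : G.Adj l b) :
    a = b := by
  unfold IsLeafVx at hl
  rw [Set.ncard_eq_one] at hl
  obtain ⟨c, hc⟩ := hl
  have h1 : a ∈ G.neighborSet l := ha
  have h2 : b ∈ G.neighborSet l := hb
  rw [hc] at h1 h2
  exact h1.trans h2.symm

lemma tdx_exists_nb [Nontrivial V] (ht : G.IsTree) (u : V) : ∃ c, G.Adj u c := by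
  obtain ⟨w, hw⟩ := exists_ne u
  obtain ⟨p⟩ := ht.connected u w
  cases p with
  | nil => exact absurd rfl hw
  | cons h _ => exact ⟨_, h⟩

lemma tdx_nonleaf [Fintype V] [Nontrivial V] (ht : G.IsTree) {u : V} (hu : ¬ IsLeafVx G u)
    (a : V) : ∃ c, G.Adj u c ∧ c ≠ a := by
  by_contra! hcon
  obtain ⟨c, hc⟩ := tdx_exists_nb ht u
  apply hu
  unfold IsLeafVx
  rw [Set.ncard_eq_one]
  refine ⟨a, Set.eq_singleton_iff_unique_mem.2 ⟨?_, fun d hd => hcon d hd⟩⟩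
  exact (hcon c hc) ▸ hc

lemma tdx_exists_leaf [Fintype V] [Nontrivial V] (ht : G.IsTree) : ∃ l, IsLeafVx G l := by
  obtain ⟨l, hl⟩ := ht.exists_vert_degree_one_of_nontrivial
  refine ⟨l, ?_⟩
  unfold IsLeafVx
  rw [Set.ncard_eq_toFinset_card', ← hl]
  rfl

lemma tdx_height_spec [Fintype V] [Nontrivial V] (ht : G.IsTree) (v : V) :
    ∃ l, IsLeafVx G l ∧ G.dist v l = heightVx G v := by
  obtain ⟨l, hl⟩ := tdx_exists_leaf ht
  have : heightVx G v ∈ {n | ∃ l, IsLeafVx G l ∧ G.Reachable v l ∧ G.dist v l = n} :=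
    Nat.sInf_mem ⟨_, l, hl, ht.connected v l, rfl⟩
  obtain ⟨l, h1, _, h2⟩ := this
  exact ⟨l, h1, h2⟩

lemma tdx_height_le (ht : G.IsTree) {v l : V} (hl : IsLeafVx G l) :
    heightVx G v ≤ G.dist v l :=
  Nat.sInf_le ⟨l, hl, ht.connected v l, rfl⟩

lemma tdx_height_zero [Fintype V] [Nontrivial V] (ht : G.IsTree) (v : V) :
    heightVx G v = 0 ↔ IsLeafVx G v := by
  constructor
  · intro h
    obtain ⟨l, hl, hd⟩ := tdx_height_spec ht v
    rw [h, ht.connected.dist_eq_zero_iff] at hd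
    exact hd ▸ hl
  · intro h
    have := tdx_height_le ht (v := v) h
    rw [SimpleGraph.dist_self] at this
    omega

lemma tdx_height_lip [Fintype V] [Nontrivial V] (ht : G.IsTree) {u w : V} (h : G.Adj u w) :
    heightVx G u ≤ heightVx G w + 1 := by
  obtain ⟨l, hl, hd⟩ := tdx_height_spec ht w
  have h1 := tdx_height_le ht (v := u) hl
  have h2 := ht.connected.dist_triangle (u := u) (v := w) (w := l)
  rw [SimpleGraph.dist_eq_one_iff_adj.2 h] at h2
  omega

lemma tdx_height_step [Fintype V] [Nontrivial V] (ht : G.IsTree) (hb : IsBalanced G) {u w : V}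
    (h : G.Adj u w) : heightVx G u = heightVx G w + 1 ∨ heightVx G w = heightVx G u + 1 := by
  have h1 := tdx_height_lip ht h
  have h2 := tdx_height_lip ht h.symm
  have h3 := hb u w h
  omega

lemma tdx_height_desc [Fintype V] [Nontrivial V] (ht : G.IsTree) {v : V} {n : ℕ}
    (h : heightVx G v = n + 1) : ∃ w, G.Adj v w ∧ heightVx G w = n := by
  obtain ⟨l, hl, hd⟩ := tdx_height_spec ht v
  obtain ⟨p, hp⟩ := ht.connected.exists_walk_length_eq_dist v l
  cases p with
  | nil => rw [SimpleGraph.dist_self] at hd; omega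
  | cons hadj q =>
    rename_i w
    refine ⟨w, hadj, ?_⟩
    have h1 := tdx_height_le ht (v := w) hl
    have h2 := SimpleGraph.dist_le q
    have h3 := tdx_height_lip ht hadj
    rw [SimpleGraph.Walk.length_cons] at hp
    omega

lemma tdx_height_down [Fintype V] [Nontrivial V] (ht : G.IsTree) (n : ℕ) :
    ∀ k (v : V), heightVx G v = n + k → ∃ w, heightVx G w = n := by
  intro k
  induction k with
  | zero => exact fun v h => ⟨v, h⟩
  | succ k ih =>
    intro v h
    obtain ⟨w, _, hw⟩ := tdx_height_desc ht (n := n + k) (by omega : heightVx G v = n + k + 1)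
    exact ih w hw

/-- parity of distance from a vertex of even height -/
lemma tdx_parity [Fintype V] [Nontrivial V] (ht : G.IsTree) (hb : IsBalanced G) (z u : V) :
    (heightVx G u + heightVx G z + G.dist z u) % 2 = 0 := by
  obtain ⟨p, hp⟩ := ht.connected.exists_walk_length_eq_dist z u
  rw [← hp]
  clear hp
  induction p with
  | nil => simp; omega
  | cons h q ih =>
    have := tdx_height_step ht hb h
    rw [SimpleGraph.Walk.length_cons]
    omega

lemma tdx_odd_nonleaf [Fintype V] [Nontrivial V] (ht : G.IsTree) (hb : IsBalanced G) {z : V}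
    (hz : heightVx G z % 2 = 0) (u : V) (hu : Odd (G.dist z u)) (a : V) :
    ∃ c, G.Adj u c ∧ c ≠ a := by
  apply tdx_nonleaf ht
  rw [← tdx_height_zero ht]
  have := tdx_parity ht hb z u
  rcases hu with ⟨k, hk⟩
  omega

lemma tdx_pos_nonleaf [Fintype V] [Nontrivial V] (ht : G.IsTree) {u : V}
    (hu : heightVx G u ≠ 0) (a : V) : ∃ c, G.Adj u c ∧ c ≠ a :=
  tdx_nonleaf ht (by rwa [← tdx_height_zero ht]) a

lemma tdx_necessity1 [Fintype V] [Nontrivial V] (ht : G.IsTree) (hb : IsBalanced G)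
    (hU : TDUnmixed G) (v : V) : heightVx G v ≤ 3 := by
  by_contra! hv
  obtain ⟨z, hz⟩ := tdx_height_down ht 4 (heightVx G v - 4) v (by omega)
  obtain ⟨w, hzw, hw⟩ := tdx_height_desc ht hz
  obtain ⟨x, hwx, hx⟩ := tdx_height_desc ht hw
  obtain ⟨y, hxy, hy⟩ := tdx_height_desc ht hx
  obtain ⟨l, hyl, hl⟩ := tdx_height_desc ht hy
  refine tdx_exchange ht hU (tdx_exists_nb ht) (tdx_odd_nonleaf ht hb (by omega)) hzw hwx hxy hyl
    (by rintro rfl; omega) (by rintro rfl; omega) (by rintro rfl; omega)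
    (fun u hu => tdx_leaf_unique ((tdx_height_zero ht l).1 hl) hu hyl.symm) ?_
  intro p hzp _
  have h1 := tdx_height_step ht hb hzp
  obtain ⟨a, hpa, haz⟩ := tdx_pos_nonleaf ht (u := p) (by omega) z
  have h2 := tdx_height_step ht hb hpa
  obtain ⟨b, hab, hbp⟩ := tdx_pos_nonleaf ht (u := a) (by omega) p
  exact ⟨a, b, hpa, haz, hab, hbp⟩

lemma tdx_necessity2 [Fintype V] [Nontrivial V] (ht : G.IsTree) (hb : IsBalanced G)
    (hU : TDUnmixed G) {x v₁ v₂ : V} (hx : heightVx G x = 2) (h1 : G.Adj x v₁) (h2 : G.Adj x v₂)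
    (hv1 : heightVx G v₁ = 1) (hv2 : heightVx G v₂ = 1) : v₁ = v₂ := by
  by_contra hne
  obtain ⟨l₁, hl1, k1⟩ := tdx_height_desc ht hv1
  obtain ⟨l₂, hl2, k2⟩ := tdx_height_desc ht hv2
  exact tdx_exchange2 ht hU (tdx_exists_nb ht) (tdx_odd_nonleaf ht hb (by omega)) h1 h2 hne hl1 hl2
    (by rintro rfl; omega) (by rintro rfl; omega)
    (fun u hu => tdx_leaf_unique ((tdx_height_zero ht _).1 k1) hu hl1.symm)
    (fun u hu => tdx_leaf_unique ((tdx_height_zero ht _).1 k2) hu hl2.symm)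

lemma tdx_necessity3 [Fintype V] [Nontrivial V] (ht : G.IsTree) (hb : IsBalanced G)
    (hU : TDUnmixed G) {v x y : V} (hv : heightVx G v = 1) (h1 : G.Adj v x) (h2 : G.Adj v y)
    (hx : heightVx G x = 2) (hy : heightVx G y = 2) : x = y := by
  by_contra hne
  obtain ⟨w, hxw, hwv⟩ := tdx_pos_nonleaf ht (u := x) (by omega) v
  have hw : heightVx G w = 3 := by
    rcases tdx_height_step ht hb hxw with h | h
    · exact absurd (tdx_necessity2 ht hb hU hx hxw h1.symm (by omega) hv) hwv
    · omega
  obtain ⟨x', hwx', hx'x⟩ := tdx_pos_nonleaf ht (u := w) (by omega) x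
  have hx' : heightVx G x' = 2 := by
    have := tdx_height_step ht hb hwx'
    have := tdx_necessity1 ht hb hU x'
    omega
  obtain ⟨v', hxv', hv'⟩ := tdx_height_desc ht hx'
  obtain ⟨l, hvl, hl⟩ := tdx_height_desc ht hv'
  refine tdx_exchange ht hU (tdx_exists_nb ht) (tdx_odd_nonleaf ht hb (z := x) (by omega)) hxw hwx'
    hxv' hvl hx'x (by rintro rfl; omega) (by rintro rfl; omega)
    (fun u hu => tdx_leaf_unique ((tdx_height_zero ht l).1 hl) hu hvl.symm) ?_
  intro p hxp _
  rcases tdx_height_step ht hb hxp with h | h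
  · have : p = v := tdx_necessity2 ht hb hU hx hxp h1.symm (by omega) hv
    subst this
    obtain ⟨b, hyb, hbp⟩ := tdx_pos_nonleaf ht (u := y) (by omega) p
    exact ⟨y, b, h2, fun e => hne e.symm, hyb, hbp⟩
  · obtain ⟨a, hpa, haz⟩ := tdx_pos_nonleaf ht (u := p) (by omega) x
    have h2 := tdx_height_step ht hb hpa
    obtain ⟨b, hab, hbp⟩ := tdx_pos_nonleaf ht (u := a) (by omega) p
    exact ⟨a, b, hpa, haz, hab, hbp⟩

lemma tdx_min_no_remove {S : Set V} (hS : IsMinTDSet G S) {s : V} (hs : s ∈ S)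
    (h : ∀ u, G.Adj s u → ∃ t ∈ S, t ≠ s ∧ G.Adj t u) : False := by
  refine hS.2 (S \ {s}) ⟨Set.sdiff_subset, fun hh => (hh hs).2 rfl⟩ ?_
  rw [tdx_iff]
  intro u
  obtain ⟨t, htS, htu⟩ := (tdx_iff S).1 hS.1 u
  by_cases e : t = s
  · obtain ⟨t', h1, h2, h3⟩ := h u (e ▸ htu)
    exact ⟨t', ⟨h1, h2⟩, h3⟩
  · exact ⟨t, ⟨htS, e⟩, htu⟩

lemma tdx_sufficiency [Fintype V] [Nontrivial V] (ht : G.IsTree) (hb : IsBalanced G)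
    (c1 : ∀ v, heightVx G v ≤ 3)
    (c2 : ∀ x v₁ v₂, heightVx G x = 2 → G.Adj x v₁ → G.Adj x v₂ → heightVx G v₁ = 1 →
      heightVx G v₂ = 1 → v₁ = v₂)
    (c3 : ∀ v x y, heightVx G v = 1 → G.Adj v x → G.Adj v y → heightVx G x = 2 →
      heightVx G y = 2 → x = y) (S : Set V) (hS : IsMinTDSet G S) :
    S.ncard = {v | heightVx G v = 1}.ncard + {v | heightVx G v = 1}.ncard := by
  have hSd := (tdx_iff S).1 hS.1
  have hV1 : ∀ v, heightVx G v = 1 → v ∈ S := by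
    intro v hv
    obtain ⟨l, hvl, hl⟩ := tdx_height_desc ht hv
    obtain ⟨s, hs, hsl⟩ := hSd l
    exact (tdx_leaf_unique ((tdx_height_zero ht l).1 hl) hsl.symm hvl.symm) ▸ hs
  have hnb1 : ∀ s, heightVx G s % 2 = 0 → ∃ v, G.Adj s v ∧ heightVx G v = 1 := by
    intro s hs
    have := c1 s
    by_cases h0 : heightVx G s = 0
    · obtain ⟨v, hv⟩ := tdx_exists_nb ht s
      have := tdx_height_step ht hb hv
      exact ⟨v, hv, by omega⟩
    · exact tdx_height_desc ht (by omega)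
  have huniq : ∀ s v₁ v₂, heightVx G s % 2 = 0 → G.Adj s v₁ → G.Adj s v₂ → heightVx G v₁ = 1 →
      heightVx G v₂ = 1 → v₁ = v₂ := by
    intro s v₁ v₂ hs h1 h2 k1 k2
    have := c1 s
    by_cases h0 : heightVx G s = 0
    · exact tdx_leaf_unique ((tdx_height_zero ht s).1 h0) h1 h2
    · exact c2 s v₁ v₂ (by omega) h1 h2 k1 k2
  have hV3 : ∀ s ∈ S, heightVx G s ≠ 3 := by
    intro s hs h3
    refine tdx_min_no_remove hS hs fun u hu => ?_
    have h1 := tdx_height_step ht hb hu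
    have h2 := c1 u
    obtain ⟨v, hv, hv1⟩ := tdx_height_desc ht (n := 1) (v := u) (by omega)
    exact ⟨v, hV1 v hv1, by rintro rfl; omega, hv.symm⟩
  have hsplit : S = {v | heightVx G v = 1} ∪ (S ∩ {v | heightVx G v % 2 = 0}) := by
    ext s
    simp only [Set.mem_union, Set.mem_inter_iff, Set.mem_ofPred_eq]
    constructor
    · intro hs
      have := hV3 s hs
      have := c1 s
      by_cases h : heightVx G s = 1
      · exact Or.inl h
      · exact Or.inr ⟨hs, by omega⟩
    · rintro (h | h)
      · exact hV1 s h
      · exact h.1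
  have hdisj : Disjoint {v | heightVx G v = 1} (S ∩ {v | heightVx G v % 2 = 0}) := by
    rw [Set.disjoint_left]
    intro s h1 h2
    simp only [Set.mem_inter_iff, Set.mem_ofPred_eq] at h1 h2
    omega
  have hleaf : ∀ v s t, s ∈ S → t ∈ S → s ≠ t → G.Adj s v → G.Adj t v → heightVx G s ≠ 0 := by
    intro v s t hs htS hne hsv htv h0
    refine tdx_min_no_remove hS hs fun u hu => ?_
    have := tdx_leaf_unique ((tdx_height_zero ht s).1 h0) hu hsv
    exact ⟨t, htS, hne.symm, this ▸ htv⟩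
  choose! g hg1 hg2 using hnb1
  have hcard : (S ∩ {v | heightVx G v % 2 = 0}).ncard = {v | heightVx G v = 1}.ncard := by
    refine Set.ncard_congr (fun s _ => g s) ?_ ?_ ?_
    · rintro s ⟨_, hs⟩
      exact hg2 s hs
    · rintro s t ⟨hs, hs0⟩ ⟨htS, ht0⟩ e
      simp only [Set.mem_ofPred_eq] at hs0 ht0 e
      by_contra hne
      have a1 := hg1 s hs0
      have a2 := hg1 t ht0
      rw [← e] at a2
      have b1 := hleaf _ s t hs htS hne a1 a2
      have b2 := hleaf _ t s htS hs (Ne.symm hne) a2 a1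
      have := c1 s
      have := c1 t
      exact hne (c3 (g s) s t (hg2 s hs0) a1.symm a2.symm (by omega) (by omega))
    · intro v hv
      simp only [Set.mem_ofPred_eq] at hv
      obtain ⟨s, hs, hsv⟩ := hSd v
      have h1 := tdx_height_step ht hb hsv
      have hs0 : heightVx G s % 2 = 0 := by omega
      exact ⟨s, ⟨hs, hs0⟩, huniq s _ _ hs0 (hg1 s hs0) hsv (hg2 s hs0) hv⟩
  rw [hsplit, Set.ncard_union_eq hdisj (Set.toFinite _) (Set.toFinite _), hcard]

lemma tdx_heightGr_le [Fintype V] [Nonempty V] (n : ℕ) :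
    heightGr G ≤ n ↔ ∀ v, heightVx G v ≤ n := by
  unfold heightGr
  constructor
  · intro h v
    exact (le_csSup (Set.toFinite _).bddAbove (Set.mem_range_self v)).trans h
  · intro h
    apply csSup_le (Set.range_nonempty _)
    rintro _ ⟨v, rfl⟩
    exact h v

/-- a support vertex without neighbors of height 2 is the center of a star -/
lemma tdx_star [Fintype V] [Nontrivial V] (ht : G.IsTree) (hb : IsBalanced G) {v : V}
    (hv : heightVx G v = 1) (h : ∀ x, G.Adj v x → heightVx G x ≠ 2) (u : V) :
    u = v ∨ G.Adj v u := by
  obtain ⟨p⟩ := ht.connected u v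
  induction p with
  | nil => exact Or.inl rfl
  | cons hadj q ih =>
    rename_i a b c
    rcases ih hv h with rfl | h'
    · exact Or.inr hadj.symm
    · have h1 := tdx_height_step ht hb h'
      have h2 := h _ h'
      exact Or.inl (tdx_leaf_unique ((tdx_height_zero ht b).1 (by omega)) hadj.symm h'.symm)

end Helpers

/-- **Theorem** (characterization of TD-unmixed balanced trees): a finite balanced tree
`T` is TD-unmixed iff (1) `height(T) ≤ 3`, (2) every vertex of height 2 has exactly one
neighbor of height 1, and (3) every vertex of height 1 has at most one neighbor of
height 2.  Moreover, if `T` is TD-unmixed of height 3 then every vertex of height 1 has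
exactly one neighbor of height 2. -/
theorem tdUnmixed_balanced_tree_characterization {V : Type} [Fintype V]
    (G : SimpleGraph V) (htree : G.IsTree) (hbal : IsBalanced G) :
    (TDUnmixed G ↔
      (heightGr G ≤ 3 ∧
        (∀ v : V, heightVx G v = 2 →
          (G.neighborSet v ∩ {w | heightVx G w = 1}).ncard = 1) ∧
        (∀ v : V, heightVx G v = 1 →
          (G.neighborSet v ∩ {w | heightVx G w = 2}).ncard ≤ 1))) ∧
    (TDUnmixed G → heightGr G = 3 →
      ∀ v : V, heightVx G v = 1 →
        (G.neighborSet v ∩ {w | heightVx G w = 2}).ncard = 1) := by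

  haveI : Nonempty V := htree.connected.nonempty
  rcases subsingleton_or_nontrivial V with hs | hn
  · have hno : ∀ u w : V, ¬ G.Adj u w := fun u w h => h.ne (Subsingleton.elim u w)
    have h0 : ∀ v : V, heightVx G v = 0 := by
      intro v
      have he : {n | ∃ l, IsLeafVx G l ∧ G.Reachable v l ∧ G.dist v l = n} = ∅ := by
        rw [Set.eq_empty_iff_forall_notMem]
        rintro n ⟨l, hl, -⟩
        have : G.neighborSet l = ∅ := by
          rw [Set.eq_empty_iff_forall_notMem]
          exact fun w hw => hno l w hw
        unfold IsLeafVx at hl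
        rw [this, Set.ncard_empty] at hl
        omega
      unfold heightVx
      rw [he, Nat.sInf_empty]
    refine ⟨⟨fun _ => ⟨?_, ?_, ?_⟩, fun _ => ?_⟩, fun _ _ v hv => ?_⟩
    · rw [tdx_heightGr_le]
      intro v
      rw [h0 v]
      omega
    · intro v hv
      have := h0 v
      omega
    · intro v hv
      have := h0 v
      omega
    · intro S₁ S₂ h1 _
      obtain ⟨v⟩ := this
      obtain ⟨s, _, hsv⟩ := (tdx_iff S₁).1 h1.1 v
      exact absurd hsv (hno s v)
    · have := h0 v
      omega
  · have key : TDUnmixed G → ∀ v : V, heightVx G v = 1 →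
        (G.neighborSet v ∩ {w | heightVx G w = 2}).ncard ≤ 1 := by
      intro hU v hv
      rw [Set.ncard_le_one (Set.toFinite _)]
      rintro x ⟨hx, hx2⟩ y ⟨hy, hy2⟩
      exact tdx_necessity3 htree hbal hU hv hx hy hx2 hy2
    refine ⟨⟨fun hU => ⟨?_, ?_, key hU⟩, ?_⟩, ?_⟩
    · rw [tdx_heightGr_le]
      exact tdx_necessity1 htree hbal hU
    · intro v hv
      obtain ⟨w, hvw, hw⟩ := tdx_height_desc htree hv
      rw [Set.ncard_eq_one]
      refine ⟨w, Set.eq_singleton_iff_unique_mem.2 ⟨⟨hvw, hw⟩, ?_⟩⟩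
      rintro x ⟨hx, hx1⟩
      exact tdx_necessity2 htree hbal hU hv hx hvw hx1 hw
    · rintro ⟨c1, c2, c3⟩
      rw [tdx_heightGr_le] at c1
      have c2' : ∀ x v₁ v₂, heightVx G x = 2 → G.Adj x v₁ → G.Adj x v₂ → heightVx G v₁ = 1 →
          heightVx G v₂ = 1 → v₁ = v₂ := by
        intro x v₁ v₂ hx h1 h2 k1 k2
        exact (Set.ncard_le_one (Set.toFinite _)).1 (c2 x hx).le v₁ ⟨h1, k1⟩ v₂ ⟨h2, k2⟩
      have c3' : ∀ v x y, heightVx G v = 1 → G.Adj v x → G.Adj v y → heightVx G x = 2 →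
          heightVx G y = 2 → x = y := by
        intro v x y hv h1 h2 k1 k2
        exact (Set.ncard_le_one (Set.toFinite _)).1 (c3 v hv) x ⟨h1, k1⟩ y ⟨h2, k2⟩
      intro S₁ S₂ h1 h2
      rw [tdx_sufficiency htree hbal c1 c2' c3' S₁ h1, tdx_sufficiency htree hbal c1 c2' c3' S₂ h2]
    · intro hU h3 v hv
      refine le_antisymm (key hU v hv) ?_
      rw [Nat.one_le_iff_ne_zero, Ne, Set.ncard_eq_zero (Set.toFinite _)]
      intro he
      have hno : ∀ x, G.Adj v x → heightVx G x ≠ 2 := fun x hx hx2 => by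
        have : x ∈ G.neighborSet v ∩ {w | heightVx G w = 2} := ⟨hx, hx2⟩
        rw [he] at this
        exact this
      have : heightGr G ≤ 2 := by
        rw [tdx_heightGr_le]
        intro u
        rcases tdx_star htree hbal hv hno u with rfl | h
        · omega
        · have := tdx_height_lip htree h.symm
          omega
      omega
end
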